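/- Existence of a global shutdown sequence: let (N,μ₀) be a perpetual free-choice system with regeneration cluster cl, let (N̂ᵢ)_{i∈I}, I = {0,…,n}, be a cl-adapted CP-exhaustion of N, and let (μ₁,μ₂) be reachable markings of (N,μ₀) with en(N,μ₁) = en(N,μ₂). Then for each i ∈ I there is a common shutdown sequence σᵢ for N̂ᵢ enabled at both μ₁ and μ₂, and the concatenation σ = σ₀*⋯*σₙ (the global shutdown sequence) is an occurrence sequence enabled at both μ₁ and μ₂. -/

import Mathlib

open Classical

/-- A (finite, bipartite) Petri *net*: disjoint finite sets of places and
transitions, and an edge relation running only between places and transitions. -/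
structure Net (α : Type*) where
  places : Finset α
  transitions : Finset α
  F : α → α → Prop
  disj : Disjoint places transitions
  edges : ∀ x y, F x y →
    (x ∈ places ∧ y ∈ transitions) ∨ (x ∈ transitions ∧ y ∈ places)

namespace Net

variable {α : Type*} [DecidableEq α]

/-- The nodes of a net. -/
def nodes (N : Net α) : Finset α := N.places ∪ N.transitions

/-- Pre-set of a node. -/
def pre (N : Net α) (x : α) : Set α := {y | N.F y x}

/-- Post-set of a node. -/
def post (N : Net α) (x : α) : Set α := {y | N.F x y}

/-- A transition `t` is enabled at a marking `μ` if every pre-place is marked. -/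
def Enabled (N : Net α) (μ : α → ℕ) (t : α) : Prop :=
  t ∈ N.transitions ∧ ∀ p, N.F p t → 1 ≤ μ p

/-- Firing a transition: remove one token from each pre-place,
add one token at each post-place. -/
noncomputable def fire (N : Net α) (t : α) (μ : α → ℕ) : α → ℕ :=
  fun p => μ p - (if N.F p t then 1 else 0) + (if N.F t p then 1 else 0)

/-- `FireSeq N μ σ ν`: the occurrence sequence `σ` is enabled at `μ` and
firing it successively leads from `μ` to `ν`. -/
inductive FireSeq (N : Net α) : (α → ℕ) → List α → (α → ℕ) → Prop
  | nil (μ : α → ℕ) : FireSeq N μ [] μ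
  | cons {μ ν : α → ℕ} {t : α} {σ : List α} :
      N.Enabled μ t → FireSeq N (N.fire t μ) σ ν → FireSeq N μ (t :: σ) ν

/-- Reachability of markings. -/
def Reach (N : Net α) (μ ν : α → ℕ) : Prop := ∃ σ : List α, N.FireSeq μ σ ν

/-- The set of transitions enabled at `μ`. -/
def en (N : Net α) (μ : α → ℕ) : Set α := {t | N.Enabled μ t}

/-- Equality of markings (as maps on the places of the net). -/
def MarkingEq (N : Net α) (μ ν : α → ℕ) : Prop := ∀ p ∈ N.places, μ p = ν p

/-- Liveness of a Petri net `(N, μ₀)`. -/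
def Live (N : Net α) (μ₀ : α → ℕ) : Prop :=
  ∀ t ∈ N.transitions, ∀ μ, N.Reach μ₀ μ → ∃ ν, N.Reach μ ν ∧ N.Enabled ν t

/-- Boundedness of a Petri net `(N, μ₀)`. -/
def Bounded (N : Net α) (μ₀ : α → ℕ) : Prop :=
  ∃ K : ℕ, ∀ μ, N.Reach μ₀ μ → ∀ p ∈ N.places, μ p ≤ K

/-- A net is well-formed if it carries a live and bounded marking. -/
def WellFormed (N : Net α) : Prop := ∃ μ₀ : α → ℕ, N.Live μ₀ ∧ N.Bounded μ₀

/-- Free-choice net: `(p,t) ∈ F` implies `•t × p• ⊆ F`. -/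
def FreeChoice (N : Net α) : Prop :=
  ∀ p ∈ N.places, ∀ t, N.F p t → ∀ p', N.F p' t → ∀ t', N.F p t' → N.F p' t'

/-- T-net: every place has exactly one pre-transition and one post-transition. -/
def IsTNet (N : Net α) : Prop :=
  ∀ p ∈ N.places, (∃! t, N.F t p) ∧ (∃! t, N.F p t)

/-- A set of nodes is cluster-closed if with each place it contains the
post-set of the place and with each transition the pre-set of the transition. -/
def ClusterClosed (N : Net α) (S : Set α) : Prop :=
  (∀ p ∈ S, p ∈ N.places → ∀ t, N.F p t → t ∈ S) ∧
  (∀ t ∈ S, t ∈ N.transitions → ∀ p, N.F p t → p ∈ S)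

/-- The cluster of a node: the smallest cluster-closed set of nodes containing it. -/
def clusterOf (N : Net α) (x : α) : Set α :=
  ⋂₀ {S : Set α | x ∈ S ∧ N.ClusterClosed S}

/-- `cl` is a cluster of `N` if it is the cluster of some node. -/
def IsCluster (N : Net α) (cl : Set α) : Prop :=
  ∃ x ∈ N.nodes, cl = N.clusterOf x

/-- The marking `μ_cl` marking exactly the places of the cluster `cl`, once. -/
noncomputable def clusterMarking (N : Net α) (cl : Set α) : α → ℕ :=
  fun p => if p ∈ cl ∧ p ∈ N.places then 1 else 0

/-- `μh` is a home marking of `(N, μ₀)`: reachable from every reachable marking. -/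
def IsHomeMarking (N : Net α) (μ₀ μh : α → ℕ) : Prop :=
  ∀ μ, N.Reach μ₀ μ → ∃ ν, N.Reach μ ν ∧ N.MarkingEq ν μh

/-- `(N, μ₀)` is perpetual with regeneration cluster `cl`: live, bounded, and
`μ_cl` is a home marking for the cluster `cl`. -/
def Perpetual (N : Net α) (μ₀ : α → ℕ) (cl : Set α) : Prop :=
  N.Live μ₀ ∧ N.Bounded μ₀ ∧ N.IsCluster cl ∧
    N.IsHomeMarking μ₀ (N.clusterMarking cl)

/-- Lucency: enabling-equivalent reachable markings are equal. -/
def Lucent (N : Net α) (μ₀ : α → ℕ) : Prop :=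
  ∀ μ₁ μ₂, N.Reach μ₀ μ₁ → N.Reach μ₀ μ₂ → N.en μ₁ = N.en μ₂ → N.MarkingEq μ₁ μ₂

/-- A path of the net: a nonempty sequence of nodes along edges. -/
def IsPath (N : Net α) (δ : List α) : Prop :=
  δ ≠ [] ∧ (∀ x ∈ δ, x ∈ N.nodes) ∧ δ.Chain' N.F

/-- A circuit: a path whose last node is connected back to its first node. -/
def IsCircuit (N : Net α) (δ : List α) : Prop :=
  N.IsPath δ ∧ ∃ h : δ ≠ [], N.F (δ.getLast h) (δ.head h)

/-- Token count of a set of nodes: total number of tokens on its places. -/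
def tokenCount (N : Net α) (μ : α → ℕ) (X : Finset α) : ℕ :=
  ∑ p ∈ X ∩ N.places, μ p

/-- The set `S` of nodes is strongly connected (in the induced subnet). -/
def StronglyConnectedOn (N : Net α) (S : Finset α) : Prop :=
  ∀ x ∈ S, ∀ y ∈ S,
    Relation.ReflTransGen (fun a b => a ∈ S ∧ b ∈ S ∧ N.F a b) x y

/-- The set `S` of nodes is weakly connected (in the induced subnet). -/
def WeaklyConnectedOn (N : Net α) (S : Finset α) : Prop :=
  ∀ x ∈ S, ∀ y ∈ S,
    Relation.ReflTransGen (fun a b => a ∈ S ∧ b ∈ S ∧ (N.F a b ∨ N.F b a)) x y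

/-- The (full) subnet spanned by `S` is transition-bordered: every place of `S`
has all its neighbours inside `S`. -/
def TransitionBordered (N : Net α) (S : Finset α) : Prop :=
  ∀ p ∈ S, p ∈ N.places → ∀ y, (N.F y p ∨ N.F p y) → y ∈ S

/-- The full subnet spanned by `S` is a T-net: each place of `S` has exactly one
pre-transition and one post-transition inside `S`. -/
def TNetOn (N : Net α) (S : Finset α) : Prop :=
  ∀ p ∈ S, p ∈ N.places →
    (∃! t, t ∈ S ∧ N.F t p) ∧ (∃! t, t ∈ S ∧ N.F p t)

/-- `S` spans a CP-subnet of `N`: nonempty, weakly connected, transition-bordered,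
a T-net, and the complement contains a transition and is strongly connected. -/
def IsCPSubnet (N : Net α) (S : Finset α) : Prop :=
  S.Nonempty ∧ S ⊆ N.nodes ∧ N.WeaklyConnectedOn S ∧ N.TransitionBordered S ∧
  N.TNetOn S ∧ ((N.nodes \ S) ∩ N.transitions).Nonempty ∧
  N.StronglyConnectedOn (N.nodes \ S)

/-- The full subnet of `N` spanned by the node set `S`, as a net. -/
def restrict (N : Net α) (S : Finset α) : Net α where
  places := N.places ∩ S
  transitions := N.transitions ∩ S
  F := fun x y => x ∈ S ∧ y ∈ S ∧ N.F x y
  disj := N.disj.mono Finset.inter_subset_left Finset.inter_subset_left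
  edges := by
    rintro x y ⟨hx, hy, hF⟩
    rcases N.edges x y hF with ⟨h1, h2⟩ | ⟨h1, h2⟩
    · exact Or.inl ⟨Finset.mem_inter.mpr ⟨h1, hx⟩, Finset.mem_inter.mpr ⟨h2, hy⟩⟩
    · exact Or.inr ⟨Finset.mem_inter.mpr ⟨h1, hx⟩, Finset.mem_inter.mpr ⟨h2, hy⟩⟩

/-- A CP-exhaustion: a family of pairwise disjoint CP-subnets whose complement
is a strongly connected T-net. -/
def IsCPExhaustion (N : Net α) {n : ℕ}
    (Nhat : Fin n → Finset α) : Prop :=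
  (∀ i, N.IsCPSubnet (Nhat i)) ∧
  (∀ i j, i ≠ j → Disjoint (Nhat i) (Nhat j)) ∧
  N.StronglyConnectedOn (N.nodes \ Finset.univ.biUnion Nhat) ∧
  N.TNetOn (N.nodes \ Finset.univ.biUnion Nhat)

/-- `t` is a way-in transition of the subnet spanned by `S`: a transition of `S`
with a pre-place outside `S`. -/
def IsWayIn (N : Net α) (S : Finset α) (t : α) : Prop :=
  t ∈ S ∧ t ∈ N.transitions ∧ ∃ p ∈ N.places, p ∉ S ∧ N.F p t

/-- A shutdown sequence for the subnet spanned by `S` (with way-in transition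
`tin`) at a marking `μ`: an occurrence sequence enabled at `μ` using only
transitions of `S` other than `tin`, after which no transition of `S` other
than (possibly) `tin` is enabled. -/
def IsShutdownSeq (N : Net α) (S : Finset α) (tin : α)
    (μ : α → ℕ) (σ : List α) (μsd : α → ℕ) : Prop :=
  N.FireSeq μ σ μsd ∧
  (∀ t ∈ σ, t ∈ S ∧ t ∈ N.transitions ∧ t ≠ tin) ∧
  (∀ t ∈ S, t ∈ N.transitions → t ≠ tin → ¬ N.Enabled μsd t)

/-- `C` spans a P-component of `N`: nonempty, strongly connected, inside `C`
every transition has exactly one pre-place and one post-place, and every place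
of `C` has all its neighbours inside `C`. -/
def IsPComponent (N : Net α) (C : Finset α) : Prop :=
  C.Nonempty ∧ C ⊆ N.nodes ∧ N.StronglyConnectedOn C ∧
  (∀ t ∈ C, t ∈ N.transitions →
    (∃! p, p ∈ C ∧ N.F p t) ∧ (∃! p, p ∈ C ∧ N.F t p)) ∧
  (∀ p ∈ C, p ∈ N.places → ∀ y, (N.F y p ∨ N.F p y) → y ∈ C)

end Net
namespace Net

variable {α : Type*} {N : Net α}

theorem place_of_edge_left {p t : α} (ht : t ∈ N.transitions) (h : N.F p t) :
    p ∈ N.places := by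
  rcases N.edges p t h with ⟨hp, -⟩ | ⟨-, hp⟩
  · exact hp
  · exact absurd ht (Finset.disjoint_left.mp N.disj hp)

theorem place_of_edge_right {t p : α} (ht : t ∈ N.transitions) (h : N.F t p) :
    p ∈ N.places := by
  rcases N.edges t p h with ⟨hp, -⟩ | ⟨-, hp⟩
  · exact absurd ht (Finset.disjoint_left.mp N.disj hp)
  · exact hp

theorem transition_of_edge_left {t p : α} (hp : p ∈ N.places) (h : N.F t p) :
    t ∈ N.transitions := by
  rcases N.edges t p h with ⟨-, ht⟩ | ⟨ht, -⟩
  · exact absurd ht (Finset.disjoint_left.mp N.disj hp)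
  · exact ht

theorem transition_of_edge_right {p t : α} (hp : p ∈ N.places) (h : N.F p t) :
    t ∈ N.transitions := by
  rcases N.edges p t h with ⟨-, ht⟩ | ⟨ht, -⟩
  · exact ht
  · exact absurd ht (Finset.disjoint_left.mp N.disj hp)

theorem place_ne_transition {p t : α} (hp : p ∈ N.places) (ht : t ∈ N.transitions) : p ≠ t :=
  fun h => Finset.disjoint_left.mp N.disj hp (h ▸ ht)

/-! ### Occurrence sequences -/

theorem FireSeq.append {μ ν ρ : α → ℕ} {σ τ : List α} (h : N.FireSeq μ σ ν)
    (h' : N.FireSeq ν τ ρ) : N.FireSeq μ (σ ++ τ) ρ := by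
  induction h with
  | nil => exact h'
  | cons ht _ ih => exact .cons ht (ih h')

theorem Reach.trans {μ ν ρ : α → ℕ} (h : N.Reach μ ν) (h' : N.Reach ν ρ) : N.Reach μ ρ := by
  obtain ⟨σ, hσ⟩ := h
  obtain ⟨τ, hτ⟩ := h'
  exact ⟨_, hσ.append hτ⟩

theorem Enabled.fireSeq {μ : α → ℕ} {t : α} (h : N.Enabled μ t) :
    N.FireSeq μ [t] (N.fire t μ) := .cons h (.nil _)

/-- Tokens on a place that no transition of the sequence feeds. -/
theorem FireSeq.count_add_le [DecidableEq α] {μ ν : α → ℕ} {σ : List α} (h : N.FireSeq μ σ ν) {p t : α}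
    (ht : N.F p t) (hp : ∀ s ∈ σ, ¬ N.F s p) : σ.count t + ν p ≤ μ p := by
  induction h with
  | nil => simp
  | @cons μ ν u σ hu _ ih =>
    have h1 := ih fun s hs => hp s (List.mem_cons_of_mem _ hs)
    have h2 := hp u List.mem_cons_self
    have h3 := hu.2 p
    simp only [fire, h2, if_false] at h1
    rw [List.count_cons]
    by_cases hpu : N.F p u
    · have := h3 hpu
      simp only [hpu, if_true] at h1
      split_ifs <;> omega
    · have : u ≠ t := fun e => hpu (e ▸ ht)
      simp only [hpu, if_false] at h1
      simp only [beq_iff_eq, this, if_false]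
      omega

/-- Tokens on a place from which no transition of the sequence consumes. -/
theorem FireSeq.add_count_le [DecidableEq α] {μ ν : α → ℕ} {σ : List α} (h : N.FireSeq μ σ ν) {p t : α}
    (ht : N.F t p) (hp : ∀ s ∈ σ, ¬ N.F p s) : μ p + σ.count t ≤ ν p := by
  induction h with
  | nil => simp
  | @cons μ ν u σ hu _ ih =>
    have h1 := ih fun s hs => hp s (List.mem_cons_of_mem _ hs)
    have h2 := hp u List.mem_cons_self
    simp only [fire, h2, if_false] at h1
    rw [List.count_cons]
    by_cases hpu : N.F u p
    · simp only [hpu, if_true] at h1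
      split_ifs <;> omega
    · have : u ≠ t := fun e => hpu (e ▸ ht)
      simp only [hpu, if_false] at h1
      simp only [beq_iff_eq, this, if_false]
      omega

/-- The state equation at a place with one input and one output transition. -/
theorem FireSeq.place_eq [DecidableEq α] {μ ν : α → ℕ} {σ : List α} (h : N.FireSeq μ σ ν) {p s t : α}
    (hs : ∀ x, N.F x p ↔ x = s) (ht : ∀ x, N.F p x ↔ x = t) :
    ν p + σ.count t = μ p + σ.count s := by
  induction h with
  | nil => simp
  | @cons μ ν u σ hu _ ih =>
    have h3 := hu.2 p
    simp only [fire, hs, ht] at ih h3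
    simp only [List.count_cons, beq_iff_eq]
    split_ifs at ih ⊢ <;> grind

theorem FireSeq.eq_of_no_edges {μ ν : α → ℕ} {σ : List α} (h : N.FireSeq μ σ ν) {p : α}
    (hs : ∀ x ∈ σ, ¬ N.F x p ∧ ¬ N.F p x) : ν p = μ p := by
  induction h with
  | nil => rfl
  | @cons μ ν u σ hu _ ih =>
    rw [ih fun x hx => hs x (List.mem_cons_of_mem _ hx)]
    have := hs u List.mem_cons_self
    simp [fire, this.1, this.2]

/-- Deleting a transition without output places keeps a sequence fireable. -/
theorem FireSeq.filter_sink [DecidableEq α] {μ ν : α → ℕ} {σ : List α} (h : N.FireSeq μ σ ν) {u : α}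
    (hu : ∀ p, ¬ N.F u p) : ∀ {μ' : α → ℕ}, (∀ p, μ p ≤ μ' p) →
      ∃ ν', N.FireSeq μ' (σ.filter (· ≠ u)) ν' := by
  induction h with
  | nil => exact fun _ => ⟨_, .nil _⟩
  | @cons μ ν t σ ht _ ih =>
    intro μ' hμ
    by_cases e : t = u
    · subst e
      simp only [ne_eq, not_true_eq_false, decide_false, Bool.false_eq_true,
        not_false_eq_true, List.filter_cons_of_neg]
      apply ih
      intro p
      have := hμ p
      simp only [fire, hu, if_false]
      omega
    · obtain ⟨ν', h'⟩ := ih (μ' := N.fire t μ') (by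
        intro p
        have := hμ p
        simp only [fire]
        omega)
      refine ⟨ν', ?_⟩
      rw [List.filter_cons_of_pos (by simpa using e)]
      exact .cons ⟨ht.1, fun p hp => (ht.2 p hp).trans (hμ p)⟩ h'

/-- A sequence all of whose transitions consume only from `S` is fireable from every
marking that agrees on `S`. -/
theorem FireSeq.transfer {μ ν : α → ℕ} {σ : List α} (h : N.FireSeq μ σ ν) {S : Finset α}
    (hS : ∀ t ∈ σ, ∀ p, N.F p t → p ∈ S) : ∀ {μ' : α → ℕ}, (∀ p ∈ S, μ p = μ' p) →
      ∃ ν', N.FireSeq μ' σ ν' ∧ ∀ p ∈ S, ν p = ν' p := by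
  induction h with
  | nil => exact fun h => ⟨_, .nil _, h⟩
  | @cons μ ν t σ ht _ ih =>
    intro μ' hμ
    obtain ⟨ν', h', hν⟩ := ih (fun s hs => hS s (List.mem_cons_of_mem _ hs))
      (μ' := N.fire t μ') (fun p hp => by simp only [fire, hμ p hp])
    refine ⟨ν', .cons ⟨ht.1, fun p hp => ?_⟩ h', hν⟩
    rw [← hμ p (hS t List.mem_cons_self p hp)]
    exact ht.2 p hp

/-- The weighted state equation. -/
theorem FireSeq.weight_eq [DecidableEq α] {μ ν : α → ℕ} {σ : List α} (h : N.FireSeq μ σ ν)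
    (P : Finset α) (y : α → ℤ) :
    ∑ p ∈ P, y p * ν p = ∑ p ∈ P, y p * μ p + ∑ s ∈ N.transitions, (σ.count s : ℤ) *
      (∑ p ∈ P, y p * (if N.F s p then 1 else 0) - ∑ p ∈ P, y p * (if N.F p s then 1 else 0)) := by
  induction h with
  | nil => simp
  | @cons μ ν t σ ht _ ih =>
    have h1 : ∀ p, ((N.fire t μ p : ℕ) : ℤ)
        = μ p - (if N.F p t then 1 else 0) + (if N.F t p then 1 else 0) := by
      intro p
      have := ht.2 p
      simp only [fire]
      split_ifs with a b <;> simp_all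
    rw [ih]
    simp only [h1, List.count_cons, Nat.cast_add, add_mul, Finset.sum_add_distrib, mul_add,
      mul_sub, Finset.sum_sub_distrib, beq_iff_eq, Nat.cast_ite, Nat.cast_one, Nat.cast_zero,
      ite_mul, one_mul, zero_mul, Finset.sum_ite_eq, ht.1, if_true]
    ring

theorem Live.exists_enabled {μ₀ μ : α → ℕ} (hl : N.Live μ₀) (hμ : N.Reach μ₀ μ)
    {t : α} (ht : t ∈ N.transitions) : ∃ s, N.Enabled μ s := by
  obtain ⟨ν, ⟨σ, hσ⟩, hν⟩ := hl t ht μ hμ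
  cases hσ with
  | nil => exact ⟨t, hν⟩
  | cons h _ => exact ⟨_, h⟩

theorem Live.exists_count_ge [DecidableEq α] {μ₀ μ : α → ℕ} (hl : N.Live μ₀) (hμ : N.Reach μ₀ μ)
    {t : α} (ht : t ∈ N.transitions) (n : ℕ) :
    ∃ σ ν, N.FireSeq μ σ ν ∧ n ≤ σ.count t := by
  induction n with
  | zero => exact ⟨[], μ, .nil _, Nat.zero_le _⟩
  | succ n ih =>
    obtain ⟨σ, ν, hσ, hn⟩ := ih
    obtain ⟨ρ, ⟨τ, hτ⟩, hρ⟩ := hl t ht ν (hμ.trans ⟨σ, hσ⟩)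
    refine ⟨_, _, (hσ.append hτ).append hρ.fireSeq, ?_⟩
    simp only [List.count_append, List.count_singleton_self]
    omega

/-! ### Recurrent sets of transitions -/

/-- Reachability by means of transitions from `U` only. -/
def ReachIn (N : Net α) (U : Set α) (μ ν : α → ℕ) : Prop :=
  ∃ σ : List α, N.FireSeq μ σ ν ∧ ∀ t ∈ σ, t ∈ U

theorem ReachIn.refl (U : Set α) (μ : α → ℕ) : N.ReachIn U μ μ := ⟨[], .nil _, by simp⟩

theorem ReachIn.reach {U : Set α} {μ ν : α → ℕ} (h : N.ReachIn U μ ν) : N.Reach μ ν :=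
  let ⟨σ, hσ, _⟩ := h
  ⟨σ, hσ⟩

theorem ReachIn.trans {U : Set α} {μ ν ρ : α → ℕ} (h : N.ReachIn U μ ν)
    (h' : N.ReachIn U ν ρ) : N.ReachIn U μ ρ := by
  obtain ⟨σ, hσ, hU⟩ := h
  obtain ⟨τ, hτ, hU'⟩ := h'
  exact ⟨_, hσ.append hτ, fun t ht => (List.mem_append.mp ht).elim (hU t) (hU' t)⟩

/-- `A` is the set of transitions that can occur from `μ` when only transitions of `U` are
fired, and each of them can be enabled again and again. -/
structure Recurrent (N : Net α) (U : Set α) (μ : α → ℕ) (A : Set α) : Prop where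
  mem : ∀ ρ, N.ReachIn U μ ρ → ∀ t ∈ U, N.Enabled ρ t → t ∈ A
  subset : A ⊆ U
  again : ∀ t ∈ A, ∀ ρ, N.ReachIn U μ ρ → ∃ ρ', N.ReachIn U ρ ρ' ∧ N.Enabled ρ' t

theorem exists_recurrent (N : Net α) (U : Set α) (μ : α → ℕ) :
    ∃ ν A, N.ReachIn U μ ν ∧ N.Recurrent U ν A := by
  let B : (α → ℕ) → Finset α := fun ν =>
    N.transitions.filter fun t => t ∈ U ∧ ∃ ρ, N.ReachIn U ν ρ ∧ N.Enabled ρ t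
  have hex : ∃ k, ∃ ν, N.ReachIn U μ ν ∧ (B ν).card = k := ⟨_, μ, .refl _ _, rfl⟩
  obtain ⟨ν, hν, hk⟩ := Nat.find_spec hex
  refine ⟨ν, B ν, hν, ?_, ?_, ?_⟩
  · intro ρ hρ t htU ht
    simp only [B, Finset.coe_filter, Set.mem_ofPred_eq]
    exact ⟨ht.1, htU, ρ, hρ, ht⟩
  · intro t ht
    simp only [B, Finset.coe_filter, Set.mem_ofPred_eq] at ht
    exact ht.2.1
  · intro t ht ρ hρ
    have hsub : B ρ ⊆ B ν := by
      intro s hs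
      simp only [B, Finset.mem_filter] at hs ⊢
      obtain ⟨h1, h2, ρ', h3, h4⟩ := hs
      exact ⟨h1, h2, ρ', hρ.trans h3, h4⟩
    have hle : (B ν).card ≤ (B ρ).card := by
      rw [hk]
      exact Nat.find_min' hex ⟨ρ, hν.trans hρ, rfl⟩
    rw [← Finset.eq_of_subset_of_card_le hsub hle] at ht
    simp only [B, Finset.coe_filter, Set.mem_ofPred_eq] at ht
    exact ht.2.2

theorem Recurrent.mem_of_fireSeq {U A : Set α} {μ ν : α → ℕ} {σ : List α}
    (hA : N.Recurrent U μ A) (hσ : N.FireSeq μ σ ν) (hU : ∀ t ∈ σ, t ∈ U) :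
    ∀ t ∈ σ, t ∈ A := by
  suffices h : ∀ ρ, N.FireSeq ρ σ ν → N.ReachIn U μ ρ → ∀ t ∈ σ, t ∈ A from
    h μ hσ (.refl _ _)
  clear hσ
  induction σ with
  | nil => simp
  | cons s σ ih =>
    intro ρ hρ hμρ t ht
    have hs := hU s List.mem_cons_self
    cases hρ with
    | cons h1 h2 =>
      rcases List.mem_cons.mp ht with rfl | ht
      · exact hA.mem ρ hμρ t hs h1
      · exact ih (fun t ht => hU t (List.mem_cons_of_mem _ ht)) _ h2
          (hμρ.trans ⟨[s], h1.fireSeq, by simpa using hs⟩) t ht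

theorem Recurrent.exists_count_ge [DecidableEq α] {U A : Set α} {μ : α → ℕ} (hA : N.Recurrent U μ A)
    {t : α} (ht : t ∈ A) (n : ℕ) :
    ∃ σ ν, N.FireSeq μ σ ν ∧ (∀ s ∈ σ, s ∈ A) ∧ n ≤ σ.count t := by
  suffices h : ∃ σ ν, N.FireSeq μ σ ν ∧ (∀ s ∈ σ, s ∈ U) ∧ n ≤ σ.count t by
    obtain ⟨σ, ν, h1, h2, h3⟩ := h
    exact ⟨σ, ν, h1, hA.mem_of_fireSeq h1 h2, h3⟩
  induction n with
  | zero => exact ⟨[], μ, .nil _, by simp, Nat.zero_le _⟩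
  | succ n ih =>
    obtain ⟨σ, ν, hσ, hU, hn⟩ := ih
    obtain ⟨ρ, ⟨τ, hτ, hU'⟩, hρ⟩ := hA.again t ht ν ⟨σ, hσ, hU⟩
    refine ⟨_, _, (hσ.append hτ).append hρ.fireSeq, ?_, ?_⟩
    · intro s hs
      simp only [List.mem_append, List.mem_singleton] at hs
      rcases hs with (hs | hs) | rfl
      · exact hU s hs
      · exact hU' s hs
      · exact hA.subset ht
    · simp only [List.count_append, List.count_singleton_self]
      omega

theorem Recurrent.exists_input {U A : Set α} {μ : α → ℕ} (hA : N.Recurrent U μ A)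
    {p t : α} (ht : t ∈ A) (hp : N.F p t) : ∃ s ∈ A, N.F s p := by
  obtain ⟨σ, ν, hσ, hU, hn⟩ := hA.exists_count_ge ht (μ p + 1)
  by_contra! hno
  have := hσ.count_add_le hp fun s hs => hno s (hU s hs)
  omega

theorem Recurrent.exists_output {U A : Set α} {μ₀ μ : α → ℕ} (hA : N.Recurrent U μ A)
    (hb : N.Bounded μ₀) (hμ : N.Reach μ₀ μ) {p t : α} (ht : t ∈ A) (hpl : p ∈ N.places)
    (hp : N.F t p) : ∃ s ∈ A, N.F p s := by
  obtain ⟨K, hK⟩ := hb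
  obtain ⟨σ, ν, hσ, hU, hn⟩ := hA.exists_count_ge ht (K + 1)
  by_contra! hno
  have := hσ.add_count_le hp fun s hs => hno s (hU s hs)
  have := hK ν (hμ.trans ⟨σ, hσ⟩) p hpl
  omega


/-! ### CP-exhaustions of perpetual free-choice systems -/

section

variable [DecidableEq α] {μ₀ : α → ℕ} {cl : Set α} {n : ℕ} {S : Fin n → Finset α}
  {tin : Fin n → α}

/-- The standing assumptions: a perpetual free-choice system with an adapted CP-exhaustion and
a choice of way-in transitions. -/
structure Exhausted (N : Net α) (μ₀ : α → ℕ) (cl : Set α) (S : Fin n → Finset α)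
    (tin : Fin n → α) : Prop where
  freeChoice : N.FreeChoice
  perpetual : N.Perpetual μ₀ cl
  exhaustion : N.IsCPExhaustion S
  adapted : ∀ i, ¬ cl ⊆ (S i : Set α)
  wayIn : ∀ i, N.IsWayIn (S i) (tin i)

/-- The nodes outside all subnets of the family. -/
def core (N : Net α) (S : Fin n → Finset α) : Finset α := N.nodes \ Finset.univ.biUnion S

theorem mem_core {x : α} : x ∈ N.core S ↔ x ∈ N.nodes ∧ ∀ i, x ∉ S i := by
  simp [core]

theorem mem_nodes_of_place {p : α} (hp : p ∈ N.places) : p ∈ N.nodes :=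
  Finset.mem_union_left _ hp

theorem mem_nodes_of_transition {t : α} (ht : t ∈ N.transitions) : t ∈ N.nodes :=
  Finset.mem_union_right _ ht

namespace Exhausted

theorem live (h : N.Exhausted μ₀ cl S tin) : N.Live μ₀ := h.perpetual.1

theorem bounded (h : N.Exhausted μ₀ cl S tin) : N.Bounded μ₀ := h.perpetual.2.1

theorem mem_of_edge_right (h : N.Exhausted μ₀ cl S tin) {i : Fin n} {p t : α} (hp : p ∈ S i)
    (hpl : p ∈ N.places) (e : N.F p t) : t ∈ S i :=
  (h.exhaustion.1 i).2.2.2.1 p hp hpl t (.inr e)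

theorem mem_of_edge_left (h : N.Exhausted μ₀ cl S tin) {i : Fin n} {p t : α} (hp : p ∈ S i)
    (hpl : p ∈ N.places) (e : N.F t p) : t ∈ S i :=
  (h.exhaustion.1 i).2.2.2.1 p hp hpl t (.inl e)

theorem index_eq (h : N.Exhausted μ₀ cl S tin) {i j : Fin n} {x : α} (hi : x ∈ S i)
    (hj : x ∈ S j) : i = j := by
  by_contra hne
  exact Finset.disjoint_left.mp (h.exhaustion.2.1 i j hne) hi hj

theorem exists_input (h : N.Exhausted μ₀ cl S tin) {i : Fin n} {p : α} (hp : p ∈ S i)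
    (hpl : p ∈ N.places) : ∃ s ∈ S i, ∀ x, N.F x p ↔ x = s := by
  obtain ⟨s, ⟨hs, e⟩, hu⟩ := ((h.exhaustion.1 i).2.2.2.2.1 p hp hpl).1
  exact ⟨s, hs, fun x => ⟨fun hx => hu x ⟨h.mem_of_edge_left hp hpl hx, hx⟩,
    fun hx => hx ▸ e⟩⟩

theorem exists_output (h : N.Exhausted μ₀ cl S tin) {i : Fin n} {p : α} (hp : p ∈ S i)
    (hpl : p ∈ N.places) : ∃ t ∈ S i, ∀ x, N.F p x ↔ x = t := by
  obtain ⟨s, ⟨hs, e⟩, hu⟩ := ((h.exhaustion.1 i).2.2.2.2.1 p hp hpl).2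
  exact ⟨s, hs, fun x => ⟨fun hx => hu x ⟨h.mem_of_edge_right hp hpl hx, hx⟩,
    fun hx => hx ▸ e⟩⟩

theorem exists_core_input (h : N.Exhausted μ₀ cl S tin) {p : α} (hp : p ∈ N.core S)
    (hpl : p ∈ N.places) : ∃ s ∈ N.core S, N.F s p ∧ ∀ x ∈ N.core S, N.F x p ↔ x = s := by
  obtain ⟨s, ⟨hs, e⟩, hu⟩ := (h.exhaustion.2.2.2 p hp hpl).1
  exact ⟨s, hs, e, fun x hx => ⟨fun hxp => hu x ⟨hx, hxp⟩, fun hxp => hxp ▸ e⟩⟩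

theorem exists_core_output (h : N.Exhausted μ₀ cl S tin) {p : α} (hp : p ∈ N.core S)
    (hpl : p ∈ N.places) : ∃ t ∈ N.core S, N.F p t ∧ ∀ x ∈ N.core S, N.F p x ↔ x = t := by
  obtain ⟨s, ⟨hs, e⟩, hu⟩ := (h.exhaustion.2.2.2 p hp hpl).2
  exact ⟨s, hs, e, fun x hx => ⟨fun hxp => hu x ⟨hx, hxp⟩, fun hxp => hxp ▸ e⟩⟩

theorem mem_core_of_input (h : N.Exhausted μ₀ cl S tin) {i : Fin n} {p t : α} (ht : t ∈ S i)
    (hpl : p ∈ N.places) (e : N.F p t) (hp : p ∉ S i) : p ∈ N.core S := by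
  refine mem_core.mpr ⟨mem_nodes_of_place hpl, fun j hj => ?_⟩
  exact hp (h.index_eq (h.mem_of_edge_right hj hpl e) ht ▸ hj)

theorem mem_core_of_output (h : N.Exhausted μ₀ cl S tin) {i : Fin n} {p t : α} (ht : t ∈ S i)
    (hpl : p ∈ N.places) (e : N.F t p) (hp : p ∉ S i) : p ∈ N.core S := by
  refine mem_core.mpr ⟨mem_nodes_of_place hpl, fun j hj => ?_⟩
  exact hp (h.index_eq (h.mem_of_edge_left hj hpl e) ht ▸ hj)

/-- A way-in transition competes with a core transition that has the same input places. -/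
theorem exists_core_rival (h : N.Exhausted μ₀ cl S tin) {i : Fin n} {t : α}
    (ht : N.IsWayIn (S i) t) :
    ∃ y ∈ N.core S, y ∈ N.transitions ∧ ∀ q, N.F q t ↔ N.F q y := by
  obtain ⟨hti, htt, p, hpl, hp, e⟩ := ht
  obtain ⟨y, hy, ey, -⟩ := h.exists_core_output (h.mem_core_of_input hti hpl e hp) hpl
  exact ⟨y, hy, transition_of_edge_right hpl ey, fun q =>
    ⟨fun hq => h.freeChoice p hpl t e q hq y ey, fun hq => h.freeChoice p hpl y ey q hq t e⟩⟩

theorem not_mem_of_wayIn_input (h : N.Exhausted μ₀ cl S tin) {i : Fin n} {t q : α}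
    (ht : N.IsWayIn (S i) t) (hq : N.F q t) : q ∉ S i := by
  obtain ⟨y, hy, -, hty⟩ := h.exists_core_rival ht
  intro hqi
  exact (mem_core.mp hy).2 i
    (h.mem_of_edge_right hqi (place_of_edge_left ht.2.1 hq) ((hty q).mp hq))

theorem cluster_subset (h : N.Exhausted μ₀ cl S tin) {p t : α} (hp : p ∈ cl)
    (hpl : p ∈ N.places) (e : N.F p t) :
    cl ⊆ {x | N.F x t} ∪ {x | ∃ q, N.F q t ∧ N.F q x} := by
  obtain ⟨x, hx, rfl⟩ := h.perpetual.2.2.1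
  have ht := transition_of_edge_right hpl e
  set B : Set α := {x | N.F x t} ∪ {x | ∃ q, N.F q t ∧ N.F q x} with hB
  have hplB : ∀ q, N.F q t → q ∈ N.places := fun q hq => place_of_edge_left ht hq
  have key : ∀ q s, q ∈ N.places → N.F q s → (q ∈ B ↔ s ∈ B) := by
    intro q s hq hqs
    constructor
    · rintro (hqt | ⟨r, hr, hrq⟩)
      · exact .inr ⟨q, hqt, hqs⟩
      · exact absurd rfl (place_ne_transition hq (transition_of_edge_right (hplB r hr) hrq))
    · rintro (hst | ⟨r, hr, hrs⟩)
      · exact absurd rfl (place_ne_transition (hplB s hst) (transition_of_edge_right hq hqs))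
      · exact .inl (h.freeChoice r (hplB r hr) s hrs q hqs t hr)
  have closed : N.ClusterClosed B :=
    ⟨fun q hqB hq s hs => (key q s hq hs).mp hqB,
      fun s hsB hs q hq => (key q s (place_of_edge_left hs hq) hq).mpr hsB⟩
  have closed' : N.ClusterClosed Bᶜ :=
    ⟨fun q hqB hq s hs hsB => hqB ((key q s hq hs).mpr hsB),
      fun s hsB hs q hq hqB => hsB ((key q s (place_of_edge_left hs hq) hq).mp hqB)⟩
  by_cases hxB : x ∈ B
  · exact Set.sInter_subset_of_mem ⟨hxB, closed⟩
  · have := Set.sInter_subset_of_mem (S := {S : Set α | x ∈ S ∧ N.ClusterClosed S})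
      ⟨hxB, closed'⟩ hp
    exact absurd (.inl e) this

theorem not_mem_of_mem_cluster (h : N.Exhausted μ₀ cl S tin) {p : α} (hp : p ∈ cl)
    (hpl : p ∈ N.places) (i : Fin n) : p ∉ S i := by
  intro hpi
  obtain ⟨t, hti, ht⟩ := h.exists_output hpi hpl
  have e : N.F p t := (ht t).mpr rfl
  have htt := transition_of_edge_right hpl e
  have hin : ∀ q, N.F q t → q ∈ S i := by
    intro q hq
    by_contra hqi
    exact h.not_mem_of_wayIn_input ⟨hti, htt, q, place_of_edge_left htt hq, hqi, hq⟩ e hpi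
  refine h.adapted i ((h.cluster_subset hp hpl e).trans ?_)
  rintro x (hx | ⟨q, hq, hqx⟩)
  · exact hin x hx
  · exact h.mem_of_edge_right (hin q hq) (place_of_edge_left htt hq) hqx

theorem exists_home (h : N.Exhausted μ₀ cl S tin) {μ : α → ℕ} (hμ : N.Reach μ₀ μ) :
    ∃ σ ν, N.FireSeq μ σ ν ∧ (∀ i, ∀ p ∈ S i, p ∈ N.places → ν p = 0) ∧
      ∀ p ∈ N.places, ν p = if p ∈ cl then 1 else 0 := by
  obtain ⟨ν, ⟨σ, hσ⟩, hν⟩ := h.perpetual.2.2.2 μ hμ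
  have hν' : ∀ p ∈ N.places, ν p = if p ∈ cl then 1 else 0 := by
    intro p hp
    rw [hν p hp]
    simp [clusterMarking, hp]
  refine ⟨σ, ν, hσ, fun i p hpi hp => ?_, hν'⟩
  rw [hν' p hp, if_neg fun hc => h.not_mem_of_mem_cluster hc hp i hpi]

/-- The subnets of the exhaustion contain no circuits, in the form of an induction principle:
no nonempty set of transitions is closed under choosing predecessors. -/
theorem not_mem_of_pred (h : N.Exhausted μ₀ cl S tin) (i : Fin n) (D : Set α)
    (hD : ∀ s ∈ D, ∃ p ∈ S i, p ∈ N.places ∧ N.F p s ∧ ∃ s' ∈ D, N.F s' p) (s : α) :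
    s ∉ D := by
  intro hs
  obtain ⟨σ, ν, hσ, hν, -⟩ := h.exists_home (μ := μ₀) ⟨[], .nil _⟩
  have inv : ∀ {μ ρ τ}, N.FireSeq μ τ ρ →
      (∀ p ∈ S i, p ∈ N.places → (∃ s ∈ D, N.F p s) → (∃ s ∈ D, N.F s p) → μ p = 0) →
      (∀ p ∈ S i, p ∈ N.places → (∃ s ∈ D, N.F p s) → (∃ s ∈ D, N.F s p) → ρ p = 0) := by
    intro μ ρ τ hτ
    induction hτ with
    | nil => exact id
    | @cons μ ν u τ hu _ ih =>
      intro hμ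
      refine ih fun p hp hpl hout hin => ?_
      have huD : u ∉ D := by
        intro huD
        obtain ⟨q, hq, hql, hqu, s', hs', hsq⟩ := hD u huD
        have h1 := hu.2 q hqu
        have h2 := hμ q hq hql ⟨u, huD, hqu⟩ ⟨s', hs', hsq⟩
        omega
      have hup : ¬ N.F u p := by
        intro hup
        obtain ⟨s', hs', hsp⟩ := hin
        obtain ⟨r, -, hr⟩ := h.exists_input hp hpl
        exact huD (((hr u).mp hup).trans ((hr s').mp hsp).symm ▸ hs')
      simp [fire, hup, hμ p hp hpl hout hin]
  have hst : s ∈ N.transitions := by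
    obtain ⟨p, -, hpl, hps, -⟩ := hD s hs
    exact transition_of_edge_right hpl hps
  obtain ⟨ρ, ⟨τ, hτ⟩, hρ⟩ := h.live s hst ν ⟨σ, hσ⟩
  obtain ⟨p, hp, hpl, hps, s', hs', hsp⟩ := hD s hs
  have h1 := hρ.2 p hps
  have h2 := inv hτ (fun p hp hpl _ _ => hν i p hp hpl) p hp hpl ⟨s, hs, hps⟩ ⟨s', hs', hsp⟩
  omega

theorem eq_empty_of_succ (h : N.Exhausted μ₀ cl S tin) (i : Fin n) (D : Finset α)
    (hD : ∀ s ∈ D, ∃ p ∈ S i, p ∈ N.places ∧ N.F s p ∧ ∃ s' ∈ D, N.F p s') : D = ∅ := by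
  have hnext : ∀ s : α, ∃ s', s ∈ D → s' ∈ D ∧ ∃ p ∈ S i, p ∈ N.places ∧ N.F s p ∧ N.F p s' := by
    intro s
    by_cases hs : s ∈ D
    · obtain ⟨p, hp, hpl, hsp, s', hs', hps⟩ := hD s hs
      exact ⟨s', fun _ => ⟨hs', p, hp, hpl, hsp, hps⟩⟩
    · exact ⟨s, fun h => absurd h hs⟩
  choose f hf using hnext
  suffices key : ∀ k, ∀ E : Finset α, E ⊆ D → (∀ s ∈ E, f s ∈ E) → E.card = k → E = ∅ from
    key _ D subset_rfl (fun s hs => (hf s hs).1) rfl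
  intro k
  induction k using Nat.strong_induction_on with
  | _ k ih =>
    intro E hED hE hk
    have hsub : E.image f ⊆ E := Finset.image_subset_iff.mpr hE
    by_cases heq : E.image f = E
    · by_contra hne
      obtain ⟨s, hs⟩ := Finset.nonempty_iff_ne_empty.mpr hne
      refine h.not_mem_of_pred i (E : Set α) (fun t ht => ?_) s hs
      rw [← heq] at ht
      obtain ⟨t', ht', rfl⟩ := Finset.mem_image.mp ht
      obtain ⟨-, p, hp, hpl, h1, h2⟩ := hf t' (hED ht')
      exact ⟨p, hp, hpl, h2, t', ht', h1⟩
    · have hlt := Finset.card_lt_card (hsub.ssubset_of_ne heq)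
      have := ih _ (hk ▸ hlt) (E.image f) (hsub.trans hED) (fun s hs =>
        Finset.mem_image_of_mem f (hsub hs)) rfl
      exact Finset.image_eq_empty.mp this

theorem exists_pre (h : N.Exhausted μ₀ cl S tin) {i : Fin n} {t : α} (hti : t ∈ S i)
    (ht : t ∈ N.transitions) : ∃ p ∈ N.places, N.F p t := by
  by_cases hne : t = tin i
  · obtain ⟨-, -, p, hpl, -, e⟩ := h.wayIn i
    exact ⟨p, hpl, hne ▸ e⟩
  rcases ((h.exhaustion.1 i).2.2.1 t hti (tin i) (h.wayIn i).1).cases_head with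
    he | ⟨p, ⟨-, hp, e | e⟩, -⟩
  · exact absurd he hne
  · by_contra! hno
    obtain ⟨K, hK⟩ := h.bounded
    have hen : ∀ μ, N.Enabled μ t := fun μ =>
      ⟨ht, fun q hq => absurd hq (hno q (place_of_edge_left ht hq))⟩
    have hrep : ∀ (k : ℕ) μ, ∃ ν, N.FireSeq μ (List.replicate k t) ν := by
      intro k
      induction k with
      | zero => exact fun μ => ⟨μ, .nil _⟩
      | succ k ih =>
        intro μ
        obtain ⟨ν, hν⟩ := ih (N.fire t μ)
        exact ⟨ν, .cons (hen μ) hν⟩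
    obtain ⟨ν, hν⟩ := hrep (K + 1) μ₀
    have hpl := place_of_edge_right ht e
    have h1 := hν.add_count_le e fun s hs => (List.eq_of_mem_replicate hs) ▸ hno p hpl
    have h2 := hK ν ⟨_, hν⟩ p hpl
    rw [List.count_replicate_self] at h1
    omega
  · exact ⟨p, place_of_edge_left ht e, e⟩

/-- While no way-in transition fires, the transitions of the subnets die out. -/
theorem not_mem_of_recurrent (h : N.Exhausted μ₀ cl S tin) {U A : Set α} {μ : α → ℕ}
    (hA : N.Recurrent U μ A) (hU : ∀ t ∈ U, ∀ i, ¬ N.IsWayIn (S i) t) {i : Fin n} {t : α}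
    (hti : t ∈ S i) (ht : t ∈ N.transitions) : t ∉ A := by
  intro htA
  refine h.not_mem_of_pred i {s | s ∈ A ∧ s ∈ S i ∧ s ∈ N.transitions} ?_ t ⟨htA, hti, ht⟩
  rintro s ⟨hsA, hsi, hs⟩
  obtain ⟨p, hpl, e⟩ := h.exists_pre hsi hs
  have hp : p ∈ S i := by
    by_contra hp
    exact hU s (hA.subset hsA) i ⟨hsi, hs, p, hpl, hp, e⟩
  obtain ⟨r, hr, hrp⟩ := hA.exists_input hsA e
  exact ⟨p, hp, hpl, e, r, ⟨hr, h.mem_of_edge_left hp hpl hrp,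
    transition_of_edge_left hpl hrp⟩, hrp⟩

/-- Without way-in transitions the core stays live. -/
theorem mem_recurrent_of_mem_core (h : N.Exhausted μ₀ cl S tin) {A : Set α} {μ : α → ℕ}
    (hμ : N.Reach μ₀ μ) (hA : N.Recurrent {t | ∀ i, ¬ N.IsWayIn (S i) t} μ A) {i : Fin n}
    {t : α} (htc : t ∈ N.core S) (ht : t ∈ N.transitions) : t ∈ A := by
  have hcoreU : ∀ y ∈ N.core S, ∀ i, ¬ N.IsWayIn (S i) y :=
    fun y hy i hw => (mem_core.mp hy).2 i hw.1
  obtain ⟨a, haA, hac, hat⟩ : ∃ a ∈ A, a ∈ N.core S ∧ a ∈ N.transitions := by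
    obtain ⟨s, hs⟩ := h.live.exists_enabled hμ (h.wayIn i).2.1
    by_cases hw : ∃ j, N.IsWayIn (S j) s
    · obtain ⟨j, hj⟩ := hw
      obtain ⟨y, hy, hyt, hsy⟩ := h.exists_core_rival hj
      exact ⟨y, hA.mem μ (.refl _ _) y (hcoreU y hy)
        ⟨hyt, fun p hp => hs.2 p ((hsy p).mpr hp)⟩, hy, hyt⟩
    · have hsA : s ∈ A := hA.mem μ (.refl _ _) s (not_exists.mp hw) hs
      exact ⟨s, hsA, mem_core.mpr ⟨mem_nodes_of_transition hs.1, fun j hj =>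
        h.not_mem_of_recurrent hA (fun _ ht => ht) hj hs.1 hsA⟩, hs.1⟩
  have key : ∀ x, Relation.ReflTransGen
      (fun a b => a ∈ N.core S ∧ b ∈ N.core S ∧ N.F a b) a x →
      (x ∈ N.transitions → x ∈ A) ∧ (x ∈ N.places → ∃ s ∈ A, N.F s x) := by
    intro x hx
    induction hx with
    | refl => exact ⟨fun _ => haA, fun hp => absurd rfl (place_ne_transition hp hat)⟩
    | @tail b c _ hbc ih =>
      obtain ⟨hb, hc, e⟩ := hbc
      constructor
      · intro hct
        have hbp := place_of_edge_left hct e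
        obtain ⟨s, hsA, hsb⟩ := ih.2 hbp
        obtain ⟨r, hrA, hbr⟩ := hA.exists_output h.bounded hμ hsA hbp hsb
        obtain ⟨ρ, hρ, hr⟩ := hA.again r hrA μ (.refl _ _)
        exact hA.mem ρ hρ c (hcoreU c hc)
          ⟨hct, fun p hp => hr.2 p (h.freeChoice b hbp c e p hp r hbr)⟩
      · intro hcp
        exact ⟨b, ih.1 (transition_of_edge_left hcp e), e⟩
  exact (key t (h.exhaustion.2.2.1 a hac t htc)).1 ht

theorem exists_enabled_wayIn (h : N.Exhausted μ₀ cl S tin) {μ : α → ℕ} (hμ : N.Reach μ₀ μ)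
    {i : Fin n} {t : α} (ht : N.IsWayIn (S i) t) :
    ∃ ν, N.ReachIn {t | ∀ i, ¬ N.IsWayIn (S i) t} μ ν ∧ N.Enabled ν t := by
  obtain ⟨ν, A, hν, hA⟩ := exists_recurrent N {t | ∀ i, ¬ N.IsWayIn (S i) t} μ
  obtain ⟨y, hy, hyt, hty⟩ := h.exists_core_rival ht
  have hyA := h.mem_recurrent_of_mem_core (i := i) (hμ.trans hν.reach) hA hy hyt
  obtain ⟨ρ, hρ, hen⟩ := hA.again y hyA ν (.refl _ _)
  exact ⟨ρ, hν.trans hρ, ht.2.1, fun p hp => hen.2 p ((hty p).mp hp)⟩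

/-- A way-in transition can fire any number of times without any other way-in transition. -/
theorem exists_count_wayIn (h : N.Exhausted μ₀ cl S tin) {μ : α → ℕ} (hμ : N.Reach μ₀ μ)
    {i : Fin n} {t : α} (ht : N.IsWayIn (S i) t) (k : ℕ) :
    ∃ σ ν, N.FireSeq μ σ ν ∧ σ.count t = k ∧
      ∀ s ∈ σ, s = t ∨ ∀ j, ¬ N.IsWayIn (S j) s := by
  induction k with
  | zero => exact ⟨[], μ, .nil _, by simp⟩
  | succ k ih =>
    obtain ⟨σ, ν, hσ, hk, hall⟩ := ih
    obtain ⟨ρ, ⟨τ, hτ, hτU⟩, hen⟩ := h.exists_enabled_wayIn (hμ.trans ⟨σ, hσ⟩) ht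
    refine ⟨_, _, (hσ.append hτ).append hen.fireSeq, ?_, ?_⟩
    · have : τ.count t = 0 := List.count_eq_zero.mpr fun hmem => hτU t hmem i ht
      simp [hk, this]
    · intro s hs
      simp only [List.mem_append, List.mem_singleton] at hs
      rcases hs with (hs | hs) | hs
      · exact hall s hs
      · exact .inr (hτU s hs)
      · exact .inl hs

theorem exists_count_le_add (h : N.Exhausted μ₀ cl S tin) {i : Fin n} {t x : α} (hti : t ∈ S i)
    (ht : t ∈ N.transitions) (hx : x ∈ S i) (hxt : x ∈ N.transitions) :
    ∃ B, ∀ σ ν, N.FireSeq μ₀ σ ν → σ.count t ≤ σ.count x + B := by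
  obtain ⟨K, hK⟩ := h.bounded
  have key : ∀ x, Relation.ReflTransGen
      (fun a b => a ∈ S i ∧ b ∈ S i ∧ (N.F a b ∨ N.F b a)) t x →
      ∃ B, (x ∈ N.transitions → ∀ σ ν, N.FireSeq μ₀ σ ν → σ.count t ≤ σ.count x + B) ∧
        (x ∈ N.places → ∀ y, (N.F x y ∨ N.F y x) → ∀ σ ν, N.FireSeq μ₀ σ ν →
          σ.count t ≤ σ.count y + B) := by
    intro x hx
    induction hx with
    | refl => exact ⟨0, fun _ _ _ _ => le_rfl, fun hp =>
        absurd rfl (place_ne_transition hp ht)⟩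
    | @tail b c _ hbc ih =>
      obtain ⟨hb, hc, e⟩ := hbc
      obtain ⟨B, hB, hB'⟩ := ih
      refine ⟨B + μ₀ c + K, fun hct σ ν hσ => ?_, fun hcp y hy σ ν hσ => ?_⟩
      · have hbp : b ∈ N.places :=
          e.elim (fun e => place_of_edge_left hct e) (fun e => place_of_edge_right hct e)
        have := hB' hbp c e σ ν hσ
        omega
      · have hbt : b ∈ N.transitions :=
          e.elim (fun e => transition_of_edge_left hcp e) (fun e => transition_of_edge_right hcp e)
        have h1 := hB hbt σ ν hσ
        obtain ⟨r, -, hr⟩ := h.exists_input hc hcp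
        obtain ⟨s, -, hs⟩ := h.exists_output hc hcp
        have h2 := hσ.place_eq hr hs
        have h3 := hK ν ⟨σ, hσ⟩ c hcp
        rw [hr, hs] at e hy
        rcases e with rfl | rfl <;> rcases hy with rfl | rfl <;> omega
  obtain ⟨B, hB, -⟩ := key x ((h.exhaustion.1 i).2.2.1 t hti x hx)
  exact ⟨B, hB hxt⟩

theorem eq_of_wayIn (h : N.Exhausted μ₀ cl S tin) {i : Fin n} {t : α}
    (ht : N.IsWayIn (S i) t) : t = tin i := by
  by_contra hne
  obtain ⟨B, hB⟩ := h.exists_count_le_add (h.wayIn i).1 (h.wayIn i).2.1 ht.1 ht.2.1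
  obtain ⟨σ, ν, hσ, hk, hall⟩ := h.exists_count_wayIn (μ := μ₀) ⟨[], .nil _⟩ (h.wayIn i) (B + 1)
  have h0 : σ.count t = 0 :=
    List.count_eq_zero.mpr fun hmem => (hall t hmem).elim hne fun hU => hU i ht
  have := hB σ ν hσ
  omega

theorem mem_of_input (h : N.Exhausted μ₀ cl S tin) {i : Fin n} {p t : α} (hti : t ∈ S i)
    (ht : t ∈ N.transitions) (hne : t ≠ tin i) (e : N.F p t) : p ∈ S i := by
  by_contra hp
  exact hne (h.eq_of_wayIn ⟨hti, ht, p, place_of_edge_left ht e, hp, e⟩)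

/-- A transition of a subnet other than its way-in transition. -/
def Inner (N : Net α) (S : Fin n → Finset α) (tin : Fin n → α) (i : Fin n) : Set α :=
  {t | t ∈ S i ∧ t ∈ N.transitions ∧ t ≠ tin i}

theorem not_wayIn_of_inner (h : N.Exhausted μ₀ cl S tin) {i j : Fin n} {t : α}
    (ht : t ∈ Inner N S tin i) : ¬ N.IsWayIn (S j) t := by
  intro hw
  obtain rfl := h.index_eq ht.1 hw.1
  exact ht.2.2 (h.eq_of_wayIn hw)

theorem exists_pre_mem (h : N.Exhausted μ₀ cl S tin) {i : Fin n} {t : α}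
    (ht : t ∈ Inner N S tin i) : ∃ p ∈ S i, p ∈ N.places ∧ N.F p t := by
  obtain ⟨p, hpl, e⟩ := h.exists_pre ht.1 ht.2.1
  exact ⟨p, h.mem_of_input ht.1 ht.2.1 ht.2.2 e, hpl, e⟩

/-- Firing inner transitions as long as possible terminates. -/
theorem exists_dead (h : N.Exhausted μ₀ cl S tin) (U : Set α)
    (hU : ∀ t ∈ U, ∃ i, t ∈ Inner N S tin i) (μ : α → ℕ) :
    ∃ ν, N.ReachIn U μ ν ∧ ∀ t ∈ U, ¬ N.Enabled ν t := by
  obtain ⟨ν, A, hν, hA⟩ := exists_recurrent N U μ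
  refine ⟨ν, hν, fun t htU ht => ?_⟩
  obtain ⟨i, hi⟩ := hU t htU
  refine h.not_mem_of_recurrent hA (fun s hs j => ?_) hi.1 hi.2.1
    (hA.mem ν (.refl _ _) t htU ht)
  obtain ⟨k, hk⟩ := hU s hs
  exact h.not_wayIn_of_inner hk

/-- The tokens on the places of a subnet are given by a height function. -/
theorem exists_height (h : N.Exhausted μ₀ cl S tin) {μ : α → ℕ} (hμ : N.Reach μ₀ μ)
    (i : Fin n) : ∃ c : α → ℕ, c (tin i) = 0 ∧
      ∀ p ∈ S i, p ∈ N.places → ∀ s t, N.F s p → N.F p t → μ p + c s = c t := by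
  obtain ⟨σ, ν, hσ, hν, -⟩ := h.exists_home hμ
  have heq : ∀ p ∈ S i, p ∈ N.places → ∀ s t, N.F s p → N.F p t →
      μ p + σ.count s = σ.count t := by
    intro p hp hpl s t hsp hpt
    obtain ⟨s', -, hs'⟩ := h.exists_input hp hpl
    obtain ⟨t', -, ht'⟩ := h.exists_output hp hpl
    rw [hs'] at hsp
    rw [ht'] at hpt
    subst hsp hpt
    have := hσ.place_eq hs' ht'
    rw [hν i p hp hpl] at this
    omega
  have hge : ∀ t ∈ S i, t ∈ N.transitions → σ.count (tin i) ≤ σ.count t := by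
    intro t hti ht
    by_contra hlt
    refine h.not_mem_of_pred i
      {t | t ∈ S i ∧ t ∈ N.transitions ∧ ¬ σ.count (tin i) ≤ σ.count t} ?_ t ⟨hti, ht, hlt⟩
    rintro t ⟨hti, ht, hlt⟩
    obtain ⟨p, hp, hpl, hpt⟩ := h.exists_pre_mem (t := t)
      ⟨hti, ht, fun e => hlt (e ▸ le_rfl)⟩
    obtain ⟨s, hs, hsp⟩ := h.exists_input hp hpl
    have hsp := (hsp s).mpr rfl
    have := heq p hp hpl s t hsp hpt
    exact ⟨p, hp, hpl, hpt, s, ⟨hs, transition_of_edge_left hpl hsp, by omega⟩, hsp⟩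
  refine ⟨fun t => σ.count t - σ.count (tin i), by simp, fun p hp hpl s t hsp hpt => ?_⟩
  have h1 := heq p hp hpl s t hsp hpt
  have h2 := hge s (h.mem_of_edge_left hp hpl hsp) (transition_of_edge_left hpl hsp)
  have h3 := hge t (h.mem_of_edge_right hp hpl hpt) (transition_of_edge_right hpl hpt)
  show μ p + (σ.count s - σ.count (tin i)) = σ.count t - σ.count (tin i)
  omega

theorem empty_of_dead (h : N.Exhausted μ₀ cl S tin) {μ : α → ℕ} (hμ : N.Reach μ₀ μ)
    {i : Fin n} (hdead : ∀ t ∈ Inner N S tin i, ¬ N.Enabled μ t) {p : α} (hp : p ∈ S i)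
    (hpl : p ∈ N.places) : μ p = 0 := by
  obtain ⟨c, hc0, hc⟩ := h.exists_height hμ i
  have hzero : ∀ t ∈ S i, t ∈ N.transitions → c t = 0 := by
    intro t hti ht
    by_contra hne
    refine h.not_mem_of_pred i {t | t ∈ S i ∧ t ∈ N.transitions ∧ c t ≠ 0} ?_ t ⟨hti, ht, hne⟩
    rintro t ⟨hti, ht, hne⟩
    have hin : t ≠ tin i := fun e => hne (e ▸ hc0)
    have hnen := hdead t ⟨hti, ht, hin⟩
    simp only [Enabled, ht, true_and, not_forall] at hnen
    obtain ⟨p, hpt, hp0⟩ := hnen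
    have hp := h.mem_of_input hti ht hin hpt
    have hpl := place_of_edge_left ht hpt
    obtain ⟨s, hs, hsp⟩ := h.exists_input hp hpl
    have hsp := (hsp s).mpr rfl
    have := hc p hp hpl s t hsp hpt
    exact ⟨p, hp, hpl, hpt, s, ⟨hs, transition_of_edge_left hpl hsp, by omega⟩, hsp⟩
  obtain ⟨s, hs, hsp⟩ := h.exists_input hp hpl
  obtain ⟨t, ht, hpt⟩ := h.exists_output hp hpl
  have hsp := (hsp s).mpr rfl
  have hpt := (hpt t).mpr rfl
  have h1 := hc p hp hpl s t hsp hpt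
  have h2 := hzero t ht (transition_of_edge_right hpl hpt)
  omega

/-- All subnets can be emptied by firing inner transitions. -/
theorem exists_empty (h : N.Exhausted μ₀ cl S tin) {μ : α → ℕ} (hμ : N.Reach μ₀ μ) :
    ∃ σ ν, N.FireSeq μ σ ν ∧ (∀ t ∈ σ, ∃ i, t ∈ Inner N S tin i) ∧
      ∀ i, ∀ p ∈ S i, p ∈ N.places → ν p = 0 := by
  obtain ⟨ν, ⟨σ, hσ, hσU⟩, hdead⟩ :=
    h.exists_dead {t | ∃ i, t ∈ Inner N S tin i} (fun _ ht => ht) μ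
  exact ⟨σ, ν, hσ, hσU, fun i p hp hpl =>
    h.empty_of_dead (hμ.trans ⟨σ, hσ⟩) (fun t ht => hdead t ⟨i, ht⟩) hp hpl⟩

theorem not_inner_wayIn (h : N.Exhausted μ₀ cl S tin) (i j : Fin n) :
    tin j ∉ Inner N S tin i :=
  fun hm => h.not_wayIn_of_inner hm (h.wayIn j)

/-- Between markings that leave a subnet empty, all its transitions fire equally often. -/
theorem count_eq_of_empty (h : N.Exhausted μ₀ cl S tin) {μ ν : α → ℕ} {σ : List α}
    (hσ : N.FireSeq μ σ ν) {i : Fin n} (hμ : ∀ p ∈ S i, p ∈ N.places → μ p = 0)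
    (hν : ∀ p ∈ S i, p ∈ N.places → ν p = 0) {t : α} (hti : t ∈ S i)
    (ht : t ∈ N.transitions) : σ.count t = σ.count (tin i) := by
  by_contra hne
  refine h.not_mem_of_pred i
    {t | t ∈ S i ∧ t ∈ N.transitions ∧ σ.count t ≠ σ.count (tin i)} ?_ t ⟨hti, ht, hne⟩
  rintro t ⟨hti, ht, hne⟩
  obtain ⟨p, hp, hpl, hpt⟩ := h.exists_pre_mem (t := t) ⟨hti, ht, fun e => hne (e ▸ rfl)⟩
  obtain ⟨s, hs, hsp⟩ := h.exists_input hp hpl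
  obtain ⟨t', -, ht'⟩ := h.exists_output hp hpl
  obtain rfl := (ht' t).mp hpt
  have h1 := hσ.place_eq hsp ht'
  rw [hμ p hp hpl, hν p hp hpl] at h1
  have hsp := (hsp s).mpr rfl
  exact ⟨p, hp, hpl, hpt, s, ⟨hs, transition_of_edge_left hpl hsp, by omega⟩, hsp⟩


/-! ### Place invariants of the core -/

/-- The places outside all subnets of the family. -/
def corePlaces (N : Net α) (S : Fin n → Finset α) : Finset α := N.core S ∩ N.places

/-- The total weight of the inputs of a transition among the core places. -/
noncomputable def inWeight (N : Net α) (S : Fin n → Finset α) (y : α → ℤ) (t : α) : ℤ :=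
  ∑ p ∈ corePlaces N S, y p * (if N.F p t then 1 else 0)

/-- The total weight of the outputs of a transition among the core places. -/
noncomputable def outWeight (N : Net α) (S : Fin n → Finset α) (y : α → ℤ) (t : α) : ℤ :=
  ∑ p ∈ corePlaces N S, y p * (if N.F t p then 1 else 0)

theorem weight_eq_of_empty (h : N.Exhausted μ₀ cl S tin) {y : α → ℤ}
    (hy : ∀ s ∈ N.core S, s ∈ N.transitions → outWeight N S y s = inWeight N S y s)
    {μ ν : α → ℕ} {σ : List α} (hσ : N.FireSeq μ σ ν)
    (hμ : ∀ i, ∀ p ∈ S i, p ∈ N.places → μ p = 0)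
    (hν : ∀ i, ∀ p ∈ S i, p ∈ N.places → ν p = 0) :
    ∑ p ∈ corePlaces N S, y p * ν p = ∑ p ∈ corePlaces N S, y p * μ p +
      ∑ i, (σ.count (tin i) : ℤ) *
        ∑ t ∈ S i ∩ N.transitions, (outWeight N S y t - inWeight N S y t) := by
  rw [hσ.weight_eq (corePlaces N S) y]
  congr 1
  change ∑ s ∈ N.transitions, (σ.count s : ℤ) * (outWeight N S y s - inWeight N S y s) = _
  have hsub : Finset.univ.biUnion (fun i => S i ∩ N.transitions) ⊆ N.transitions := by
    intro s hs
    simp only [Finset.mem_biUnion, Finset.mem_inter] at hs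
    obtain ⟨i, -, -, hs⟩ := hs
    exact hs
  rw [← Finset.sum_subset hsub, Finset.sum_biUnion]
  · refine Finset.sum_congr rfl fun i _ => ?_
    rw [Finset.mul_sum]
    refine Finset.sum_congr rfl fun t ht => ?_
    rw [Finset.mem_inter] at ht
    rw [h.count_eq_of_empty hσ (hμ i) (hν i) ht.1 ht.2]
  · intro i _ j _ hne
    exact (h.exhaustion.2.1 i j hne).mono Finset.inter_subset_left Finset.inter_subset_left
  · intro s hs hns
    rw [hy s (mem_core.mpr ⟨mem_nodes_of_transition hs, fun i hi => hns ?_⟩) hs, sub_self, mul_zero]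
    exact Finset.mem_biUnion.mpr ⟨i, Finset.mem_univ i, Finset.mem_inter.mpr ⟨hi, hs⟩⟩

theorem sum_gain_eq_zero (h : N.Exhausted μ₀ cl S tin) {y : α → ℤ} (hy0 : ∀ p, 0 ≤ y p)
    (hy : ∀ s ∈ N.core S, s ∈ N.transitions → outWeight N S y s = inWeight N S y s) (i : Fin n) :
    ∑ t ∈ S i ∩ N.transitions, (outWeight N S y t - inWeight N S y t) = 0 := by
  obtain ⟨K, hK⟩ := h.bounded
  obtain ⟨σ, M, hσ, -, hM⟩ := h.exists_empty (μ := μ₀) ⟨[], .nil _⟩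
  have hw0 : ∀ M : α → ℕ, 0 ≤ ∑ p ∈ corePlaces N S, y p * M p := fun M =>
    Finset.sum_nonneg fun p _ => mul_nonneg (hy0 p) (by positivity)
  have hwB : ∀ M, N.Reach μ₀ M →
      ∑ p ∈ corePlaces N S, y p * M p ≤ ∑ p ∈ corePlaces N S, y p * K := fun M hr =>
    Finset.sum_le_sum fun p hp => mul_le_mul_of_nonneg_left
      (by exact_mod_cast hK M hr p (Finset.mem_inter.mp hp).2) (hy0 p)
  set B := ∑ p ∈ corePlaces N S, y p * K
  set E := ∑ t ∈ S i ∩ N.transitions, (outWeight N S y t - inWeight N S y t) with hE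
  have key : ∀ k : ℕ, ∃ M', N.Reach μ₀ M' ∧ ∑ p ∈ corePlaces N S, y p * M' p =
      ∑ p ∈ corePlaces N S, y p * M p + k * E := by
    intro k
    obtain ⟨τ, ν, hτ, hk, hall⟩ := h.exists_count_wayIn ⟨σ, hσ⟩ (h.wayIn i) k
    obtain ⟨ρ, M', hρ, hin, hM'⟩ := h.exists_empty (Reach.trans ⟨σ, hσ⟩ ⟨τ, hτ⟩)
    refine ⟨M', .trans ⟨σ, hσ⟩ (.trans ⟨τ, hτ⟩ ⟨ρ, hρ⟩), ?_⟩
    rw [h.weight_eq_of_empty hy (hτ.append hρ) hM hM', Finset.sum_eq_single i]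
    · have : ρ.count (tin i) = 0 := List.count_eq_zero.mpr fun hm =>
        (hin _ hm).elim fun j hj => h.not_inner_wayIn j i hj
      rw [List.count_append, hk, this, add_zero]
    · intro j _ hne
      have h1 : ρ.count (tin j) = 0 := List.count_eq_zero.mpr fun hm =>
        (hin _ hm).elim fun k hk => h.not_inner_wayIn k j hk
      have h2 : τ.count (tin j) = 0 := List.count_eq_zero.mpr fun hm =>
        (hall _ hm).elim (fun e => hne (h.index_eq (h.wayIn j).1 (e ▸ (h.wayIn i).1)))
          fun hU => hU j (h.wayIn j)
      rw [List.count_append, h1, h2]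
      simp
    · simp
  have hB : 0 ≤ B := (hw0 M).trans (hwB M ⟨σ, hσ⟩)
  obtain ⟨M', hr, hM'⟩ := key (B + 1).toNat
  have h1 := hw0 M
  have h2 := hwB M ⟨σ, hσ⟩
  have h3 := hw0 M'
  have h4 := hwB M' hr
  rw [Int.toNat_of_nonneg (by omega)] at hM'
  by_contra hne
  rcases lt_or_gt_of_ne hne with hlt | hgt <;> nlinarith

theorem weight_eq_cluster (h : N.Exhausted μ₀ cl S tin) {y : α → ℤ} (hy0 : ∀ p, 0 ≤ y p)
    (hy : ∀ s ∈ N.core S, s ∈ N.transitions → outWeight N S y s = inWeight N S y s)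
    {μ : α → ℕ} (hr : N.Reach μ₀ μ) (hμ : ∀ i, ∀ p ∈ S i, p ∈ N.places → μ p = 0) :
    ∑ p ∈ corePlaces N S, y p * μ p = ∑ p ∈ corePlaces N S, y p * (if p ∈ cl then 1 else 0) := by
  obtain ⟨σ, ν, hσ, hν, hcl⟩ := h.exists_home hr
  have := h.weight_eq_of_empty hy hσ hμ hν
  simp only [h.sum_gain_eq_zero hy0 hy, mul_zero, Finset.sum_const_zero, add_zero] at this
  rw [← this]
  refine Finset.sum_congr rfl fun p hp => ?_
  rw [hcl p (Finset.mem_inter.mp hp).2]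
  split <;> simp

/-- Some core transition consumes from all places of the regeneration cluster. -/
theorem exists_cluster_transition (h : N.Exhausted μ₀ cl S tin) (i : Fin n) :
    ∃ t ∈ N.core S, t ∈ N.transitions ∧ ∀ p ∈ cl, p ∈ N.places → N.F p t := by
  by_cases hp : ∃ p ∈ cl, p ∈ N.places
  · obtain ⟨p, hp, hpl⟩ := hp
    obtain ⟨t, htc, e, -⟩ := h.exists_core_output
      (mem_core.mpr ⟨mem_nodes_of_place hpl, h.not_mem_of_mem_cluster hp hpl⟩) hpl
    have ht := transition_of_edge_right hpl e
    refine ⟨t, htc, ht, fun q hq hql => ?_⟩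
    rcases h.cluster_subset hp hpl e hq with hq | ⟨r, hr, hrq⟩
    · exact hq
    · exact absurd rfl (place_ne_transition hql
        (transition_of_edge_right (place_of_edge_left ht hr) hrq))
  · obtain ⟨t, htc, ht, -⟩ := h.exists_core_rival (h.wayIn i)
    exact ⟨t, htc, ht, fun p hpc hpl => absurd ⟨p, hpc, hpl⟩ hp⟩

theorem inWeight_add (y z : α → ℤ) (t : α) :
    inWeight N S (y + z) t = inWeight N S y t + inWeight N S z t := by
  simp only [inWeight, Pi.add_apply, add_mul, Finset.sum_add_distrib]

theorem outWeight_add (y z : α → ℤ) (t : α) :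
    outWeight N S (y + z) t = outWeight N S y t + outWeight N S z t := by
  simp only [outWeight, Pi.add_apply, add_mul, Finset.sum_add_distrib]

theorem inWeight_single {p : α} (hp : p ∈ corePlaces N S) (t : α) :
    inWeight N S (Pi.single p 1) t = if N.F p t then 1 else 0 := by
  rw [inWeight, Finset.sum_eq_single p (fun q _ hq => by simp [hq]) (fun hn => absurd hp hn)]
  simp

theorem outWeight_single {p : α} (hp : p ∈ corePlaces N S) (t : α) :
    outWeight N S (Pi.single p 1) t = if N.F t p then 1 else 0 := by
  rw [outWeight, Finset.sum_eq_single p (fun q _ hq => by simp [hq]) (fun hn => absurd hp hn)]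
  simp

/-- A unit flow in the core from `t` to the node `x` that does not return to `t`. -/
theorem exists_flow_from (h : N.Exhausted μ₀ cl S tin) {t x : α} (htc : t ∈ N.core S)
    (ht : t ∈ N.transitions)
    (hx : Relation.ReflTransGen (fun a b => a ∈ N.core S ∧ b ∈ N.core S ∧ N.F a b) t x) :
    ∃ y : α → ℤ, (∀ p, 0 ≤ y p) ∧ (x ∈ N.transitions → inWeight N S y t = 0 ∧
        ∀ s ∈ N.core S, s ∈ N.transitions → outWeight N S y s + (if s = x then 1 else 0) =
          inWeight N S y s + (if s = t then 1 else 0)) ∧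
      (x ∈ N.places → inWeight N S y t = (if N.F x t then 1 else 0) ∧
        ∀ s ∈ N.core S, s ∈ N.transitions → outWeight N S y s + (if N.F x s then 1 else 0) =
          inWeight N S y s + (if s = t then 1 else 0)) := by
  have hzero : ∃ y : α → ℤ, (∀ p, 0 ≤ y p) ∧ (t ∈ N.transitions → inWeight N S y t = 0 ∧
        ∀ s ∈ N.core S, s ∈ N.transitions → outWeight N S y s + (if s = t then 1 else 0) =
          inWeight N S y s + (if s = t then 1 else 0)) ∧
      (t ∈ N.places → inWeight N S y t = (if N.F t t then 1 else 0) ∧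
        ∀ s ∈ N.core S, s ∈ N.transitions → outWeight N S y s + (if N.F t s then 1 else 0) =
          inWeight N S y s + (if s = t then 1 else 0)) :=
    ⟨0, fun _ => le_rfl, fun _ => by simp [inWeight, outWeight],
      fun hp => absurd rfl (place_ne_transition hp ht)⟩
  induction hx with
  | refl => exact hzero
  | @tail b c _ hbc ih =>
    obtain ⟨hb, hc, e⟩ := hbc
    obtain ⟨y, hy0, hyt, hyp⟩ := ih
    by_cases hct : c = t
    · exact hct ▸ hzero
    by_cases hcp : c ∈ N.places
    · have hbt := transition_of_edge_left hcp e
      obtain ⟨h0, hflow⟩ := hyt hbt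
      have hcP : c ∈ corePlaces N S := Finset.mem_inter.mpr ⟨hc, hcp⟩
      obtain ⟨r, -, -, hr⟩ := h.exists_core_input hc hcp
      obtain rfl := (hr b hb).mp e
      refine ⟨y + Pi.single c 1, fun p => add_nonneg (hy0 p) ?_, fun hcT =>
        absurd rfl (place_ne_transition hcp hcT), fun _ => ⟨?_, fun s hs hsT => ?_⟩⟩
      · by_cases hp : p = c
        · subst hp; simp
        · simp [hp]
      · rw [inWeight_add, inWeight_single hcP, h0, zero_add]
      · have := hflow s hs hsT
        rw [inWeight_add, inWeight_single hcP, outWeight_add, outWeight_single hcP]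
        simp only [hr s hs]
        linarith
    · refine ⟨y, hy0, fun hcT => ?_, fun hp => absurd hp hcp⟩
      have hbp := place_of_edge_left hcT e
      obtain ⟨h0, hflow⟩ := hyp hbp
      obtain ⟨r, -, -, hr⟩ := h.exists_core_output hb hbp
      obtain rfl := (hr c hc).mp e
      refine ⟨?_, fun s hs hsT => ?_⟩
      · rw [h0, if_neg fun htb => hct ((hr t htc).mp htb).symm]
      · have := hflow s hs hsT
        simpa only [hr s hs] using this

/-- A unit flow in the core from the node `x` to `t` that does not pass through `t` before. -/
theorem exists_flow_to (h : N.Exhausted μ₀ cl S tin) {t x : α} (htc : t ∈ N.core S)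
    (ht : t ∈ N.transitions)
    (hx : Relation.ReflTransGen (fun a b => a ∈ N.core S ∧ b ∈ N.core S ∧ N.F a b) x t) :
    ∃ y : α → ℤ, (∀ p, 0 ≤ y p) ∧
      (x ∈ N.transitions → inWeight N S y t = (if x = t then 0 else 1) ∧
        ∀ s ∈ N.core S, s ∈ N.transitions → outWeight N S y s + (if s = t then 1 else 0) =
          inWeight N S y s + (if s = x then 1 else 0)) ∧
      (x ∈ N.places → 1 ≤ y x ∧ inWeight N S y t = 1 ∧
        ∀ s ∈ N.core S, s ∈ N.transitions → outWeight N S y s + (if s = t then 1 else 0) =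
          inWeight N S y s + (if N.F s x then 1 else 0)) := by
  have hzero : ∃ y : α → ℤ, (∀ p, 0 ≤ y p) ∧
      (t ∈ N.transitions → inWeight N S y t = (if t = t then 0 else 1) ∧
        ∀ s ∈ N.core S, s ∈ N.transitions → outWeight N S y s + (if s = t then 1 else 0) =
          inWeight N S y s + (if s = t then 1 else 0)) ∧
      (t ∈ N.places → 1 ≤ y t ∧ inWeight N S y t = 1 ∧
        ∀ s ∈ N.core S, s ∈ N.transitions → outWeight N S y s + (if s = t then 1 else 0) =
          inWeight N S y s + (if N.F s t then 1 else 0)) :=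
    ⟨0, fun _ => le_rfl, fun _ => by simp [inWeight, outWeight],
      fun hp => absurd rfl (place_ne_transition hp ht)⟩
  induction hx using Relation.ReflTransGen.head_induction_on with
  | refl => exact hzero
  | @head c b hcb _ ih =>
    obtain ⟨hc, hb, e⟩ := hcb
    obtain ⟨y, hy0, hyt, hyp⟩ := ih
    by_cases hct : c = t
    · exact hct ▸ hzero
    by_cases hcp : c ∈ N.places
    · have hbt := transition_of_edge_right hcp e
      obtain ⟨h0, hflow⟩ := hyt hbt
      have hcP : c ∈ corePlaces N S := Finset.mem_inter.mpr ⟨hc, hcp⟩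
      obtain ⟨r, -, -, hr⟩ := h.exists_core_output hc hcp
      obtain rfl := (hr b hb).mp e
      refine ⟨y + Pi.single c 1, fun p => add_nonneg (hy0 p) ?_, fun hcT =>
        absurd rfl (place_ne_transition hcp hcT), fun _ => ⟨?_, ?_, fun s hs hsT => ?_⟩⟩
      · by_cases hp : p = c
        · subst hp; simp
        · simp [hp]
      · simpa using hy0 c
      · rw [inWeight_add, inWeight_single hcP, h0]
        simp only [hr t htc, eq_comm (a := t)]
        split_ifs <;> simp
      · have := hflow s hs hsT
        rw [inWeight_add, inWeight_single hcP, outWeight_add, outWeight_single hcP]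
        simp only [hr s hs]
        linarith
    · refine ⟨y, hy0, fun hcT => ?_, fun hp => absurd hp hcp⟩
      have hbp := place_of_edge_right hcT e
      obtain ⟨-, h0, hflow⟩ := hyp hbp
      obtain ⟨r, -, -, hr⟩ := h.exists_core_input hb hbp
      obtain rfl := (hr c hc).mp e
      refine ⟨?_, fun s hs hsT => ?_⟩
      · rw [h0, if_neg hct]
      · have := hflow s hs hsT
        simpa only [hr s hs] using this

/-- Every core place lies in a place invariant with weight one at the given core transition. -/
theorem exists_invariant (h : N.Exhausted μ₀ cl S tin) {t p : α} (htc : t ∈ N.core S)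
    (ht : t ∈ N.transitions) (hp : p ∈ N.core S) (hpl : p ∈ N.places) :
    ∃ y : α → ℤ, (∀ q, 0 ≤ y q) ∧ 1 ≤ y p ∧ inWeight N S y t = 1 ∧
      ∀ s ∈ N.core S, s ∈ N.transitions → outWeight N S y s = inWeight N S y s := by
  obtain ⟨a, hac, e, ha⟩ := h.exists_core_input hp hpl
  obtain ⟨y, hy0, hy, -⟩ := h.exists_flow_from htc ht (h.exhaustion.2.2.1 t htc a hac)
  obtain ⟨z, hz0, -, hz⟩ := h.exists_flow_to htc ht (h.exhaustion.2.2.1 p hp t htc)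
  obtain ⟨hyt, hy⟩ := hy (transition_of_edge_left hpl e)
  obtain ⟨hzp, hzt, hz⟩ := hz hpl
  refine ⟨y + z, fun q => add_nonneg (hy0 q) (hz0 q), ?_, ?_, fun s hs hsT => ?_⟩
  · have := hy0 p
    show 1 ≤ y p + z p
    omega
  · rw [inWeight_add, hyt, hzt, zero_add]
  · have h1 := hy s hs hsT
    have h2 := hz s hs hsT
    simp only [ha s hs] at h2
    rw [inWeight_add, outWeight_add]
    linarith

/-- With all subnets empty, the core places carry at most one token. -/
theorem le_one_of_empty (h : N.Exhausted μ₀ cl S tin) (i : Fin n) {μ : α → ℕ}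
    (hr : N.Reach μ₀ μ) (hμ : ∀ i, ∀ p ∈ S i, p ∈ N.places → μ p = 0) {p : α}
    (hp : p ∈ N.core S) (hpl : p ∈ N.places) : μ p ≤ 1 := by
  obtain ⟨t, htc, ht, hcl⟩ := h.exists_cluster_transition i
  obtain ⟨y, hy0, hyp, hyt, hinv⟩ := h.exists_invariant htc ht hp hpl
  have hpC : p ∈ corePlaces N S := Finset.mem_inter.mpr ⟨hp, hpl⟩
  have h1 : y p * μ p ≤ ∑ q ∈ corePlaces N S, y q * μ q :=
    Finset.single_le_sum (f := fun q => y q * (μ q : ℤ))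
      (fun q _ => mul_nonneg (hy0 q) (by positivity)) hpC
  have h2 : ∑ q ∈ corePlaces N S, y q * (if q ∈ cl then 1 else 0) ≤ inWeight N S y t := by
    refine Finset.sum_le_sum fun q hq => mul_le_mul_of_nonneg_left ?_ (hy0 q)
    by_cases hqc : q ∈ cl
    · rw [if_pos hqc, if_pos (hcl q hqc (Finset.mem_inter.mp hq).2)]
    · rw [if_neg hqc]
      split_ifs <;> simp
  rw [← h.weight_eq_cluster hy0 hinv hr hμ, hyt] at h2
  have : (μ p : ℤ) ≤ 1 := by nlinarith
  exact_mod_cast this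

/-- Every inner transition has an output place. -/
theorem exists_post (h : N.Exhausted μ₀ cl S tin) {i : Fin n} {t : α}
    (ht : t ∈ Inner N S tin i) : ∃ p ∈ N.places, N.F t p := by
  by_contra! hno
  have hno : ∀ p, ¬ N.F t p := fun p e => hno p (place_of_edge_right ht.2.1 e) e
  obtain ⟨q, hq, hql, e⟩ := h.exists_pre_mem ht
  obtain ⟨s, -, hs⟩ := h.exists_input hq hql
  obtain ⟨t', -, ht'⟩ := h.exists_output hq hql
  obtain rfl := (ht' t).mp e
  have hsq := (hs s).mpr rfl
  obtain ⟨K, hK⟩ := h.bounded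
  obtain ⟨σ, ν, hσ, hk⟩ := h.live.exists_count_ge (μ := μ₀) ⟨[], .nil _⟩
    (transition_of_edge_left hql hsq) (K + 1)
  obtain ⟨ν', hσ'⟩ := hσ.filter_sink hno (μ' := μ₀) fun _ => le_rfl
  have h1 := hσ'.add_count_le hsq fun x hx hqx => by
    obtain rfl := (ht' x).mp hqx
    simp at hx
  have h2 : (σ.filter (· ≠ t)).count s = σ.count s :=
    List.count_filter (by simpa using fun hst : s = t => hno q (hst ▸ hsq))
  have h3 := hK ν' ⟨_, hσ'⟩ q hql
  omega

/-- Emptying the subnets fires every transition at most once. -/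
theorem count_le_one (h : N.Exhausted μ₀ cl S tin) {μ ν : α → ℕ} {σ : List α}
    (hr : N.Reach μ₀ μ) (hσ : N.FireSeq μ σ ν) (hin : ∀ t ∈ σ, ∃ i, t ∈ Inner N S tin i)
    (hν : ∀ i, ∀ p ∈ S i, p ∈ N.places → ν p = 0) {i : Fin n} {t : α} (hti : t ∈ S i)
    (ht : t ∈ N.transitions) : σ.count t ≤ 1 := by
  by_contra hlt
  have hD : (S i).filter (fun t => t ∈ N.transitions ∧ 2 ≤ σ.count t) = ∅ := by
    refine h.eq_empty_of_succ i _ fun t hmem => ?_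
    rw [Finset.mem_filter] at hmem
    obtain ⟨hti, ht, h2⟩ := hmem
    have hinner : t ∈ Inner N S tin i := by
      refine ⟨hti, ht, ?_⟩
      rintro rfl
      have h0 : 0 < σ.count (tin i) := by omega
      obtain ⟨j, hj⟩ := hin _ (List.count_pos_iff.mp h0)
      exact h.not_inner_wayIn j i hj
    obtain ⟨p, hpl, e⟩ := h.exists_post hinner
    have hp : p ∈ S i := by
      by_contra hp
      have hpc := h.mem_core_of_output hti hpl e hp
      have h1 := hσ.add_count_le e fun s hs hps => by
        obtain ⟨j, hj⟩ := hin s hs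
        exact (mem_core.mp hpc).2 j (h.mem_of_input hj.1 hj.2.1 hj.2.2 hps)
      have := h.le_one_of_empty i (hr.trans ⟨σ, hσ⟩) hν hpc hpl
      omega
    obtain ⟨s, -, hs⟩ := h.exists_input hp hpl
    obtain ⟨t', ht'i, ht'⟩ := h.exists_output hp hpl
    obtain rfl := (hs t).mp e
    have h1 := hσ.place_eq hs ht'
    rw [hν i p hp hpl] at h1
    have hpt' := (ht' t').mpr rfl
    exact ⟨p, hp, hpl, e, t', Finset.mem_filter.mpr
      ⟨ht'i, transition_of_edge_right hpl hpt', by omega⟩, hpt'⟩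
  have : t ∈ (S i).filter (fun t => t ∈ N.transitions ∧ 2 ≤ σ.count t) :=
    Finset.mem_filter.mpr ⟨hti, ht, by omega⟩
  rw [hD] at this
  simp at this

theorem exists_height_le_one (h : N.Exhausted μ₀ cl S tin) {μ : α → ℕ} (hμ : N.Reach μ₀ μ)
    (i : Fin n) : ∃ c : α → ℕ, c (tin i) = 0 ∧ (∀ t ∈ S i, t ∈ N.transitions → c t ≤ 1) ∧
      ∀ p ∈ S i, p ∈ N.places → ∀ s t, N.F s p → N.F p t → μ p + c s = c t := by
  obtain ⟨σ, ν, hσ, hin, hν⟩ := h.exists_empty hμ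
  refine ⟨σ.count, List.count_eq_zero.mpr fun hm =>
    (hin _ hm).elim fun j hj => h.not_inner_wayIn j i hj,
    fun t hti ht => h.count_le_one hμ hσ hin hν hti ht, fun p hp hpl s t hsp hpt => ?_⟩
  obtain ⟨s', -, hs'⟩ := h.exists_input hp hpl
  obtain ⟨t', -, ht'⟩ := h.exists_output hp hpl
  obtain rfl := (hs' s).mp hsp
  obtain rfl := (ht' t).mp hpt
  have := hσ.place_eq hs' ht'
  rw [hν i p hp hpl] at this
  show μ p + σ.count s = σ.count t
  omega

/-- Markings with the same enabled transitions agree on the places of the subnets. -/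
theorem eq_of_en_eq (h : N.Exhausted μ₀ cl S tin) {μ₁ μ₂ : α → ℕ} (h₁ : N.Reach μ₀ μ₁)
    (h₂ : N.Reach μ₀ μ₂) (hen : N.en μ₁ = N.en μ₂) (i : Fin n) {p : α} (hp : p ∈ S i)
    (hpl : p ∈ N.places) : μ₁ p = μ₂ p := by
  obtain ⟨c, hc0, hc1, hc⟩ := h.exists_height_le_one h₁ i
  obtain ⟨d, hd0, hd1, hd⟩ := h.exists_height_le_one h₂ i
  have hen' : ∀ t, N.Enabled μ₁ t ↔ N.Enabled μ₂ t := fun t => Set.ext_iff.mp hen t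
  have step : ∀ (μ μ' c d : α → ℕ), c (tin i) = 0 → (∀ t, N.Enabled μ t ↔ N.Enabled μ' t) →
      (∀ p ∈ S i, p ∈ N.places → ∀ s t, N.F s p → N.F p t → μ p + c s = c t) →
      (∀ p ∈ S i, p ∈ N.places → ∀ s t, N.F s p → N.F p t → μ' p + d s = d t) →
      ∀ t ∈ S i, t ∈ N.transitions → c t = 1 → d t = 0 →
      ∃ p ∈ S i, p ∈ N.places ∧ N.F p t ∧
        ∃ s ∈ S i, s ∈ N.transitions ∧ c s = 1 ∧ d s = 0 ∧ N.F s p := by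
    intro μ μ' c d hc0 hen hc hd t hti ht hct hdt
    have hne : t ≠ tin i := by
      rintro rfl
      omega
    by_contra! hno
    have hmark : N.Enabled μ t := by
      refine ⟨ht, fun p hpt => ?_⟩
      have hp := h.mem_of_input hti ht hne hpt
      have hpl := place_of_edge_left ht hpt
      obtain ⟨s, hs, hsp⟩ := h.exists_input hp hpl
      have hsp := (hsp s).mpr rfl
      have h1 := hc p hp hpl s t hsp hpt
      have h2 := hd p hp hpl s t hsp hpt
      by_contra h0
      exact hno p hp hpl hpt s hs (transition_of_edge_left hpl hsp) (by omega) (by omega) hsp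
    obtain ⟨p, hp, hpl, hpt⟩ := h.exists_pre_mem ⟨hti, ht, hne⟩
    obtain ⟨s, hs, hsp⟩ := h.exists_input hp hpl
    have h2 := hd p hp hpl s t ((hsp s).mpr rfl) hpt
    have h3 := ((hen t).mp hmark).2 p hpt
    omega
  have heq : ∀ t ∈ S i, t ∈ N.transitions → c t = d t := by
    intro t hti ht
    by_contra hne
    refine h.not_mem_of_pred i {t | t ∈ S i ∧ t ∈ N.transitions ∧ c t ≠ d t} ?_ t ⟨hti, ht, hne⟩
    rintro t ⟨hti, ht, hne⟩
    have hct := hc1 t hti ht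
    have hdt := hd1 t hti ht
    rcases Nat.lt_or_gt_of_ne hne with hlt | hgt
    · obtain ⟨p, hp, hpl, hpt, s, hs, hsT, hds, hcs, hsp⟩ :=
        step μ₂ μ₁ d c hd0 (fun t => (hen' t).symm) hd hc t hti ht (by omega) (by omega)
      exact ⟨p, hp, hpl, hpt, s, ⟨hs, hsT, by omega⟩, hsp⟩
    · obtain ⟨p, hp, hpl, hpt, s, hs, hsT, hds, hcs, hsp⟩ :=
        step μ₁ μ₂ c d hc0 hen' hc hd t hti ht (by omega) (by omega)
      exact ⟨p, hp, hpl, hpt, s, ⟨hs, hsT, by omega⟩, hsp⟩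
  obtain ⟨s, hs, hsp⟩ := h.exists_input hp hpl
  obtain ⟨t, ht, hpt⟩ := h.exists_output hp hpl
  have hsp := (hsp s).mpr rfl
  have hpt := (hpt t).mpr rfl
  have h1 := hc p hp hpl s t hsp hpt
  have h2 := hd p hp hpl s t hsp hpt
  have h3 := heq s hs (transition_of_edge_left hpl hsp)
  have h4 := heq t ht (transition_of_edge_right hpl hpt)
  omega

/-- Inner occurrence sequences of distinct subnets do not interfere. -/
theorem exists_fireSeq_flatten (h : N.Exhausted μ₀ cl S tin) {σs : Fin n → List α} {μ : α → ℕ}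
    (hσs : ∀ i, ∃ ν, N.FireSeq μ (σs i) ν) (hin : ∀ i, ∀ t ∈ σs i, t ∈ Inner N S tin i)
    (l : List (Fin n)) (hl : l.Nodup) (μ' : α → ℕ)
    (hμ' : ∀ i ∈ l, ∀ p ∈ S i, p ∈ N.places → μ p = μ' p) :
    ∃ ν, N.FireSeq μ' (l.map σs).flatten ν := by
  induction l generalizing μ' with
  | nil => exact ⟨μ', .nil _⟩
  | cons i l ih =>
    obtain ⟨hil, hl⟩ := List.nodup_cons.mp hl
    obtain ⟨ν, hν⟩ := hσs i
    obtain ⟨ν', hν', -⟩ := hν.transfer (S := S i ∩ N.places) (μ' := μ')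
      (fun t ht p e => by
        obtain ⟨h1, h2, h3⟩ := hin i t ht
        exact Finset.mem_inter.mpr ⟨h.mem_of_input h1 h2 h3 e, place_of_edge_left h2 e⟩)
      (fun p hp => hμ' i List.mem_cons_self p (Finset.mem_inter.mp hp).1
        (Finset.mem_inter.mp hp).2)
    obtain ⟨ρ, hρ⟩ := ih hl ν' fun j hj p hp hpl => by
      rw [hμ' j (List.mem_cons_of_mem _ hj) p hp hpl]
      refine (hν'.eq_of_no_edges fun t ht => ?_).symm
      have hne : ∀ e : t ∈ S j, False := fun e =>
        hil (h.index_eq (hin i t ht).1 e ▸ hj)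
      exact ⟨fun e => hne (h.mem_of_edge_left hp hpl e), fun e => hne (h.mem_of_edge_right hp hpl e)⟩
    exact ⟨ρ, by simpa using hν'.append hρ⟩

theorem exists_shutdown (h : N.Exhausted μ₀ cl S tin) {μ₁ μ₂ : α → ℕ} (h₁ : N.Reach μ₀ μ₁)
    (h₂ : N.Reach μ₀ μ₂) (hen : N.en μ₁ = N.en μ₂) (i : Fin n) :
    ∃ σ, (∃ ν, N.IsShutdownSeq (S i) (tin i) μ₁ σ ν) ∧
      ∃ ν, N.IsShutdownSeq (S i) (tin i) μ₂ σ ν := by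
  obtain ⟨ν, ⟨σ, hσ, hin⟩, hdead⟩ :=
    h.exists_dead (Inner N S tin i) (fun t ht => ⟨i, ht⟩) μ₁
  have hpre : ∀ t ∈ Inner N S tin i, ∀ p, N.F p t → p ∈ S i ∩ N.places := fun t ht p e =>
    Finset.mem_inter.mpr ⟨h.mem_of_input ht.1 ht.2.1 ht.2.2 e, place_of_edge_left ht.2.1 e⟩
  obtain ⟨ν', hσ', heq⟩ := hσ.transfer (S := S i ∩ N.places) (μ' := μ₂)
    (fun t ht => hpre t (hin t ht))
    (fun p hp => h.eq_of_en_eq h₁ h₂ hen i (Finset.mem_inter.mp hp).1 (Finset.mem_inter.mp hp).2)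
  refine ⟨σ, ⟨ν, hσ, hin, fun t hti ht hne => hdead t ⟨hti, ht, hne⟩⟩,
    ν', hσ', hin, fun t hti ht hne hent => hdead t ⟨hti, ht, hne⟩ ⟨ht, fun p e => ?_⟩⟩
  rw [heq p (hpre t ⟨hti, ht, hne⟩ p e)]
  exact hent.2 p e

end Exhausted

end

end Net

/-- **Existence of a global shutdown sequence.** Let `(N, μ₀)` be a perpetual
free-choice system with regeneration cluster `cl`, let `(N̂ᵢ)_{i}` be a
`cl`-adapted CP-exhaustion with way-in transitions `tin i`, and let `μ₁, μ₂`
be reachable markings with `en(N,μ₁) = en(N,μ₂)`. Then each `N̂ᵢ` has a common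
shutdown sequence `σᵢ` enabled at both `μ₁` and `μ₂`, and the concatenation
`σ = σ₀ * ⋯ * σₙ` is an occurrence sequence enabled at both `μ₁` and `μ₂`. -/
theorem exists_global_shutdown_sequence
    {α : Type*} [DecidableEq α] (N : Net α) (μ₀ : α → ℕ) (cl : Set α)
    (hfc : N.FreeChoice) (hperp : N.Perpetual μ₀ cl)
    (n : ℕ) (Nhat : Fin (n + 1) → Finset α)
    (hex : N.IsCPExhaustion Nhat) (had : ∀ i, ¬ cl ⊆ (Nhat i : Set α))
    (tin : Fin (n + 1) → α) (htin : ∀ i, N.IsWayIn (Nhat i) (tin i))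
    (μ₁ μ₂ : α → ℕ) (h₁ : N.Reach μ₀ μ₁) (h₂ : N.Reach μ₀ μ₂)
    (hen : N.en μ₁ = N.en μ₂) :
    ∃ σs : Fin (n + 1) → List α,
      (∀ i, (∃ ν, N.IsShutdownSeq (Nhat i) (tin i) μ₁ (σs i) ν) ∧
            (∃ ν, N.IsShutdownSeq (Nhat i) (tin i) μ₂ (σs i) ν)) ∧
      (∃ ν₁, N.FireSeq μ₁ (List.ofFn σs).flatten ν₁) ∧
      (∃ ν₂, N.FireSeq μ₂ (List.ofFn σs).flatten ν₂) := by
  have h : N.Exhausted μ₀ cl Nhat tin := ⟨hfc, hperp, hex, had, htin⟩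
  choose σs hσs using h.exists_shutdown h₁ h₂ hen
  have hflat : ∀ μ, (∀ i, ∃ ν, N.IsShutdownSeq (Nhat i) (tin i) μ (σs i) ν) →
      ∃ ν, N.FireSeq μ (List.ofFn σs).flatten ν := by
    intro μ hμ
    rw [List.ofFn_eq_map]
    exact h.exists_fireSeq_flatten (fun i => (hμ i).imp fun _ hν => hν.1)
      (fun i => (hμ i).elim fun _ hν => hν.2.1) _ (List.nodup_finRange _) μ
      fun _ _ _ _ _ => rfl
  exact ⟨σs, hσs, hflat μ₁ fun i => (hσs i).1, hflat μ₂ fun i => (hσs i).2⟩
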